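/- arXiv:2202.05969 — 2 statements merged into one kernel-verified Lean document; each statement's English description precedes it below -/
import Mathlib

section
/- Estimate of the term I₅: there exists a constant C > 0 depending only on τ₀ such that, under the standing assumptions, ∑_{n≥0} ∑_{|α|=n} |I^α_5| τⁿ Mₙ / ‖θ ⟨r⟩ⁿ ∂^α_h g‖_{L²} ≤ C τ^{−2} ( ‖g‖_{X_τ} + ‖g‖_{D_τ} ) ‖g‖_{X_τ}. -/
open MeasureTheory Filter Set

noncomputable section

/-- `⟨t⟩ = 1 + t` -/
def angT (t : ℝ) : ℝ := 1 + t

/-- `θ_λ(z) = exp (λ z² / (8⟨t⟩))`; `θ = θ₁`. -/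
def thw (t lam z : ℝ) : ℝ := Real.exp (lam * z ^ 2 / (8 * angT t))

/-- `⟨r⟩ = √(x² + y² + 1)` -/
def angR (x y : ℝ) : ℝ := Real.sqrt (x ^ 2 + y ^ 2 + 1)

/-- `Mₙ = (n+1)⁴ / n!` -/
def Mfac (n : ℕ) : ℝ := ((n : ℝ) + 1) ^ 4 / (n.factorial : ℝ)

/-- `∂_x` -/
def pdx (f : ℝ → ℝ → ℝ → ℝ) : ℝ → ℝ → ℝ → ℝ := fun x y z => deriv (fun x' => f x' y z) x
/-- `∂_y` -/
def pdy (f : ℝ → ℝ → ℝ → ℝ) : ℝ → ℝ → ℝ → ℝ := fun x y z => deriv (fun y' => f x y' z) y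
/-- `∂_z` -/
def pdz (f : ℝ → ℝ → ℝ → ℝ) : ℝ → ℝ → ℝ → ℝ := fun x y z => deriv (fun z' => f x y z') z

/-- `∂^α_h = ∂_x^{α₁} ∂_y^{α₂}` for the multi-index `α = (a, b)` -/
def pdh (a b : ℕ) (f : ℝ → ℝ → ℝ → ℝ) : ℝ → ℝ → ℝ → ℝ := pdx^[a] (pdy^[b] f)

/-- `r ∂_r = x ∂_x + y ∂_y` -/
def rdr (f : ℝ → ℝ → ℝ → ℝ) : ℝ → ℝ → ℝ → ℝ := fun x y z => x * pdx f x y z + y * pdy f x y z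

/-- weighted `L²` norm over `ℝ² × (0,∞)` of `θ_λ ⟨r⟩ⁿ f` -/
def L2w (t lam : ℝ) (n : ℕ) (f : ℝ → ℝ → ℝ → ℝ) : ℝ :=
  Real.sqrt (∫ x : ℝ, ∫ y : ℝ, ∫ z in Ioi (0 : ℝ), (thw t lam z * angR x y ^ n * f x y z) ^ 2)

/-- weighted `L²_z` norm at fixed `(x, y)` of `θ_λ ⟨r⟩ⁿ f (x, y, ·)` -/
def L2z (t lam : ℝ) (n : ℕ) (f : ℝ → ℝ → ℝ → ℝ) (x y : ℝ) : ℝ :=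
  Real.sqrt (∫ z in Ioi (0 : ℝ), (thw t lam z * angR x y ^ n * f x y z) ^ 2)

/-- mixed `L^∞_h L²_z` norm of `θ_λ ⟨r⟩ⁿ f` -/
def LIh2z (t lam : ℝ) (n : ℕ) (f : ℝ → ℝ → ℝ → ℝ) : ℝ :=
  Real.sqrt (∫ z in Ioi (0 : ℝ), (⨆ p : ℝ × ℝ, |thw t lam z * angR p.1 p.2 ^ n * f p.1 p.2 z|) ^ 2)

/-- mixed `L²_h L^∞_z` norm of `θ_λ ⟨r⟩ⁿ f` -/
def L2hIz (t lam : ℝ) (n : ℕ) (f : ℝ → ℝ → ℝ → ℝ) : ℝ :=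
  Real.sqrt (∫ x : ℝ, ∫ y : ℝ,
    (⨆ z : Ioi (0 : ℝ), |thw t lam (z : ℝ) * angR x y ^ n * f x y (z : ℝ)|) ^ 2)

/-- the primitive `φ(x,y,z) = exp(−z²/(4⟨t⟩)) ∫₀^z g(x,y,s) exp(s²/(4⟨t⟩)) ds` -/
def phiF (t : ℝ) (g : ℝ → ℝ → ℝ → ℝ) : ℝ → ℝ → ℝ → ℝ := fun x y z =>
  Real.exp (-(z ^ 2) / (4 * angT t)) * ∫ s in (0 : ℝ)..z, g x y s * Real.exp (s ^ 2 / (4 * angT t))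

/-- `u^r = ∂_z φ` -/
def ur (t : ℝ) (g : ℝ → ℝ → ℝ → ℝ) : ℝ → ℝ → ℝ → ℝ := pdz (phiF t g)

/-- `u^z = −(x∂_x + y∂_y)φ − 2φ` -/
def uzv (t : ℝ) (g : ℝ → ℝ → ℝ → ℝ) : ℝ → ℝ → ℝ → ℝ := fun x y z =>
  -(rdr (phiF t g) x y z) - 2 * phiF t g x y z

/-- smoothness together with rapid decay in `z` of all derivatives -/
def DecaySmooth (g : ℝ → ℝ → ℝ → ℝ) : Prop :=
  ContDiff ℝ (⊤ : ℕ∞) (fun p : ℝ × ℝ × ℝ => g p.1 p.2.1 p.2.2) ∧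
  ∀ a b k m : ℕ, ∀ x y : ℝ,
    Tendsto (fun z : ℝ => z ^ m * pdz^[k] (pdh a b g) x y z) atTop (nhds 0)

/-- `θ ⟨r⟩^{|α|} ∂^α_h g ∈ L²(ℝ² × (0,∞))` for every `α` -/
def L2cond (t : ℝ) (g : ℝ → ℝ → ℝ → ℝ) : Prop :=
  ∀ a b : ℕ,
    Integrable
      (fun p : ℝ × ℝ × ℝ =>
        (thw t 1 p.2.2 * angR p.1 p.2.1 ^ (a + b) * pdh a b g p.1 p.2.1 p.2.2) ^ 2)
      (volume.restrict {p : ℝ × ℝ × ℝ | 0 < p.2.2})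

/-- `θ ⟨r⟩^{|α|} ∂^α_h ∂_z g ∈ L²(ℝ² × (0,∞))` for every `α` -/
def L2condZ (t : ℝ) (g : ℝ → ℝ → ℝ → ℝ) : Prop :=
  ∀ a b : ℕ,
    Integrable
      (fun p : ℝ × ℝ × ℝ =>
        (thw t 1 p.2.2 * angR p.1 p.2.1 ^ (a + b) * pdh a b (pdz g) p.1 p.2.1 p.2.2) ^ 2)
      (volume.restrict {p : ℝ × ℝ × ℝ | 0 < p.2.2})

/-- `X_n(g, τ)` -/
def Xel (t τ : ℝ) (g : ℝ → ℝ → ℝ → ℝ) (n : ℕ) : ℝ :=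
  (∑ a ∈ Finset.range (n + 1), L2w t 1 n (pdh a (n - a) g)) * τ ^ n * Mfac n

/-- `D_n(g, τ) = X_n(∂_z g, τ)` -/
def Del (t τ : ℝ) (g : ℝ → ℝ → ℝ → ℝ) (n : ℕ) : ℝ :=
  (∑ a ∈ Finset.range (n + 1), L2w t 1 n (pdh a (n - a) (pdz g))) * τ ^ n * Mfac n

/-- `Y_n(g, τ)` (with `Y₀ = 0`) -/
def Yel (t τ : ℝ) (g : ℝ → ℝ → ℝ → ℝ) (n : ℕ) : ℝ :=
  (∑ a ∈ Finset.range (n + 1), L2w t 1 n (pdh a (n - a) g)) * τ ^ (n - 1) * (n : ℝ) * Mfac n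

/-- `‖g‖_{X_τ}` -/
def Xnrm (t τ : ℝ) (g : ℝ → ℝ → ℝ → ℝ) : ℝ := ∑' n : ℕ, Xel t τ g n
/-- `‖g‖_{D_τ}` -/
def Dnrm (t τ : ℝ) (g : ℝ → ℝ → ℝ → ℝ) : ℝ := ∑' n : ℕ, Del t τ g n
/-- `‖g‖_{Y_τ}` -/
def Ynrm (t τ : ℝ) (g : ℝ → ℝ → ℝ → ℝ) : ℝ := ∑' n : ℕ, Yel t τ g n

/-- triple integral over `ℝ² × (0,∞)` -/
def trip (F : ℝ → ℝ → ℝ → ℝ) : ℝ := ∫ x : ℝ, ∫ y : ℝ, ∫ z in Ioi (0 : ℝ), F x y z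

/-- `I^α_1` -/
def I1 (t : ℝ) (g : ℝ → ℝ → ℝ → ℝ) (a b : ℕ) : ℝ :=
  -trip fun x y z =>
    thw t 2 z * angR x y ^ (2 * (a + b)) *
      pdh a b (fun x' y' z' => ur t g x' y' z' * rdr g x' y' z') x y z * pdh a b g x y z

/-- `I^α_2` -/
def I2 (t : ℝ) (g : ℝ → ℝ → ℝ → ℝ) (a b : ℕ) : ℝ :=
  -trip fun x y z =>
    thw t 2 z * angR x y ^ (2 * (a + b)) *
      pdh a b (fun x' y' z' => uzv t g x' y' z' * pdz g x' y' z') x y z * pdh a b g x y z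

/-- `I^α_3` -/
def I3 (t : ℝ) (g : ℝ → ℝ → ℝ → ℝ) (a b : ℕ) : ℝ :=
  -trip fun x y z =>
    thw t 2 z * angR x y ^ (2 * (a + b)) *
      pdh a b (fun x' y' z' => ur t g x' y' z' ^ 2) x y z * pdh a b g x y z

/-- `I^α_4` -/
def I4 (t : ℝ) (g : ℝ → ℝ → ℝ → ℝ) (a b : ℕ) : ℝ :=
  (1 / (2 * angT t)) * trip fun x y z =>
    thw t 2 z * angR x y ^ (2 * (a + b)) *
      pdh a b
        (fun x' y' z' =>
          uzv t g x' y' z' * pdz (fun x'' y'' w => w * phiF t g x'' y'' w) x' y' z') x y z *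
      pdh a b g x y z

/-- `I^α_5` -/
def I5 (t : ℝ) (g : ℝ → ℝ → ℝ → ℝ) (a b : ℕ) : ℝ :=
  -(1 / angT t) * trip fun x y z =>
    z * thw t 2 z * angR x y ^ (2 * (a + b)) *
      pdh a b (fun x' y' z' => ur t g x' y' z' * phiF t g x' y' z') x y z * pdh a b g x y z

/-- `I^α_6` -/
def I6 (t : ℝ) (g : ℝ → ℝ → ℝ → ℝ) (a b : ℕ) : ℝ :=
  -(1 / (2 * angT t)) * trip fun x y z =>
    z * thw t 2 z * angR x y ^ (2 * (a + b)) *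
      (∫ s in Ioi z, pdh a b (fun x' y' z' => ur t g x' y' z' ^ 2) x y s) * pdh a b g x y z

/-- `I^α_7` -/
def I7 (t : ℝ) (g : ℝ → ℝ → ℝ → ℝ) (a b : ℕ) : ℝ :=
  (1 / angT t) * trip fun x y z =>
    z * thw t 2 z * angR x y ^ (2 * (a + b)) *
      (∫ s in Ioi z, pdh a b (fun x' y' z' => pdz (ur t g) x' y' z' * uzv t g x' y' z') x y s) *
      pdh a b g x y z

/-- `∑_{|α| = n} |I^α| τⁿ Mₙ / ‖θ ⟨r⟩ⁿ ∂^α_h g‖_{L²}` (with the convention `x / 0 = 0`) -/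
def Qterm (t τ : ℝ) (g : ℝ → ℝ → ℝ → ℝ) (I : ℕ → ℕ → ℝ) (n : ℕ) : ℝ :=
  ∑ a ∈ Finset.range (n + 1), |I a (n - a)| * τ ^ n * Mfac n / L2w t 1 n (pdh a (n - a) g)

/-- `∂_t` -/
def pdt (G : ℝ → ℝ → ℝ → ℝ → ℝ) (t x y z : ℝ) : ℝ := deriv (fun t' => G t' x y z) t

/-- the good-unknown axially symmetric Prandtl equation at the point `(t, x, y, z)` -/
def GoodEq (G : ℝ → ℝ → ℝ → ℝ → ℝ) (t x y z : ℝ) : Prop :=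
  pdt G t x y z
      + ur t (G t) x y z * rdr (G t) x y z
      + uzv t (G t) x y z * pdz (G t) x y z
      - pdz (pdz (G t)) x y z
      + G t x y z / angT t
      + ur t (G t) x y z ^ 2
      - 1 / (2 * angT t) * (uzv t (G t) x y z * pdz (fun x' y' w => w * phiF t (G t) x' y' w) x y z)
      + z / angT t * (ur t (G t) x y z * phiF t (G t) x y z)
      + z / (2 * angT t) * (∫ s in Ioi z, ur t (G t) x y s ^ 2)
      - z / angT t * (∫ s in Ioi z, pdz (ur t (G t)) x y s * uzv t (G t) x y s) = 0

/-- joint smoothness in `(x, y, z)` -/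
def SmoothXYZ (f : ℝ → ℝ → ℝ → ℝ) : Prop :=
  ContDiff ℝ (⊤ : ℕ∞) (fun p : ℝ × ℝ × ℝ => f p.1 p.2.1 p.2.2)

lemma angT_pos {t : ℝ} (ht : 0 ≤ t) : 0 < angT t := by unfold angT; linarith

lemma SmoothXYZ.continuous {f : ℝ → ℝ → ℝ → ℝ} (hf : SmoothXYZ f) :
    Continuous (fun p : ℝ × ℝ × ℝ => f p.1 p.2.1 p.2.2) := ContDiff.continuous hf

lemma SmoothXYZ.hasDerivAt_fderiv_x {f : ℝ → ℝ → ℝ → ℝ} (hf : SmoothXYZ f) (x y z : ℝ) :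
    HasDerivAt (fun x' => f x' y z)
      (fderiv ℝ (fun p : ℝ × ℝ × ℝ => f p.1 p.2.1 p.2.2) (x, y, z) (1, 0, 0)) x := by
  have h1 := ((hf.differentiable (by simp)) (x, y, z)).hasFDerivAt
  have h2 : HasDerivAt (fun x' : ℝ => ((x', y, z) : ℝ × ℝ × ℝ)) (1, 0, 0) x :=
    (hasDerivAt_id x).prodMk ((hasDerivAt_const x y).prodMk (hasDerivAt_const x z))
  exact h1.comp_hasDerivAt x h2

lemma SmoothXYZ.hasDerivAt_fderiv_y {f : ℝ → ℝ → ℝ → ℝ} (hf : SmoothXYZ f) (x y z : ℝ) :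
    HasDerivAt (fun y' => f x y' z)
      (fderiv ℝ (fun p : ℝ × ℝ × ℝ => f p.1 p.2.1 p.2.2) (x, y, z) (0, 1, 0)) y := by
  have h1 := ((hf.differentiable (by simp)) (x, y, z)).hasFDerivAt
  have h2 : HasDerivAt (fun y' : ℝ => ((x, y', z) : ℝ × ℝ × ℝ)) (0, 1, 0) y :=
    (hasDerivAt_const y x).prodMk ((hasDerivAt_id y).prodMk (hasDerivAt_const y z))
  exact h1.comp_hasDerivAt y h2

lemma SmoothXYZ.pdx_eq {f : ℝ → ℝ → ℝ → ℝ} (hf : SmoothXYZ f) (x y z : ℝ) :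
    pdx f x y z = fderiv ℝ (fun p : ℝ × ℝ × ℝ => f p.1 p.2.1 p.2.2) (x, y, z) (1, 0, 0) :=
  (hf.hasDerivAt_fderiv_x x y z).deriv

lemma SmoothXYZ.pdy_eq {f : ℝ → ℝ → ℝ → ℝ} (hf : SmoothXYZ f) (x y z : ℝ) :
    pdy f x y z = fderiv ℝ (fun p : ℝ × ℝ × ℝ => f p.1 p.2.1 p.2.2) (x, y, z) (0, 1, 0) :=
  (hf.hasDerivAt_fderiv_y x y z).deriv

lemma SmoothXYZ.hasDerivAt_x {f : ℝ → ℝ → ℝ → ℝ} (hf : SmoothXYZ f) (x y z : ℝ) :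
    HasDerivAt (fun x' => f x' y z) (pdx f x y z) x := by
  rw [hf.pdx_eq]; exact hf.hasDerivAt_fderiv_x x y z

lemma SmoothXYZ.hasDerivAt_y {f : ℝ → ℝ → ℝ → ℝ} (hf : SmoothXYZ f) (x y z : ℝ) :
    HasDerivAt (fun y' => f x y' z) (pdy f x y z) y := by
  rw [hf.pdy_eq]; exact hf.hasDerivAt_fderiv_y x y z

lemma SmoothXYZ.pdx {f : ℝ → ℝ → ℝ → ℝ} (hf : SmoothXYZ f) : SmoothXYZ (pdx f) := by
  have h : ContDiff ℝ (⊤ : ℕ∞) (fun p : ℝ × ℝ × ℝ =>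
      fderiv ℝ (fun p : ℝ × ℝ × ℝ => f p.1 p.2.1 p.2.2) p (1, 0, 0)) :=
    (ContDiff.fderiv_right hf (by simp)).clm_apply contDiff_const
  unfold SmoothXYZ
  convert h using 2 with p
  exact hf.pdx_eq _ _ _

lemma SmoothXYZ.pdy {f : ℝ → ℝ → ℝ → ℝ} (hf : SmoothXYZ f) : SmoothXYZ (pdy f) := by
  have h : ContDiff ℝ (⊤ : ℕ∞) (fun p : ℝ × ℝ × ℝ =>
      fderiv ℝ (fun p : ℝ × ℝ × ℝ => f p.1 p.2.1 p.2.2) p (0, 1, 0)) :=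
    (ContDiff.fderiv_right hf (by simp)).clm_apply contDiff_const
  unfold SmoothXYZ
  convert h using 2 with p
  exact hf.pdy_eq _ _ _

lemma SmoothXYZ.pdy_pdx {f : ℝ → ℝ → ℝ → ℝ} (hf : SmoothXYZ f) :
    _root_.pdy (_root_.pdx f) = _root_.pdx (_root_.pdy f) := by
  funext x y z
  rw [hf.pdx.pdy_eq, hf.pdy.pdx_eq]
  have e1 : (fun p : ℝ × ℝ × ℝ => _root_.pdx f p.1 p.2.1 p.2.2) = fun p =>
      fderiv ℝ (fun p : ℝ × ℝ × ℝ => f p.1 p.2.1 p.2.2) p (1, 0, 0) := by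
    funext p; exact hf.pdx_eq _ _ _
  have e2 : (fun p : ℝ × ℝ × ℝ => _root_.pdy f p.1 p.2.1 p.2.2) = fun p =>
      fderiv ℝ (fun p : ℝ × ℝ × ℝ => f p.1 p.2.1 p.2.2) p (0, 1, 0) := by
    funext p; exact hf.pdy_eq _ _ _
  have hd : DifferentiableAt ℝ (fderiv ℝ (fun p : ℝ × ℝ × ℝ => f p.1 p.2.1 p.2.2)) (x, y, z) :=
    ((ContDiff.fderiv_right (m := 1) hf (by norm_cast)).differentiable (by simp)) _
  have hs : IsSymmSndFDerivAt ℝ (fun p : ℝ × ℝ × ℝ => f p.1 p.2.1 p.2.2) (x, y, z) :=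
    ContDiffAt.isSymmSndFDerivAt (ContDiff.contDiffAt hf)
      (by simp only [minSmoothness_of_isRCLikeNormedField]; exact WithTop.coe_le_coe.2 le_top)
  rw [e1, e2, fderiv_clm_apply hd (by fun_prop), fderiv_clm_apply hd (by fun_prop)]
  simpa using hs.eq (0, 1, 0) (1, 0, 0)

lemma SmoothXYZ.iterate_pdx {f : ℝ → ℝ → ℝ → ℝ} (hf : SmoothXYZ f) (a : ℕ) :
    SmoothXYZ (_root_.pdx^[a] f) := by
  induction a with
  | zero => exact hf
  | succ a ih => rw [Function.iterate_succ_apply']; exact ih.pdx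

lemma SmoothXYZ.iterate_pdy {f : ℝ → ℝ → ℝ → ℝ} (hf : SmoothXYZ f) (b : ℕ) :
    SmoothXYZ (_root_.pdy^[b] f) := by
  induction b with
  | zero => exact hf
  | succ a ih => rw [Function.iterate_succ_apply']; exact ih.pdy

lemma SmoothXYZ.pdh {f : ℝ → ℝ → ℝ → ℝ} (hf : SmoothXYZ f) (a b : ℕ) :
    SmoothXYZ (pdh a b f) := (hf.iterate_pdy b).iterate_pdx a

lemma pdx_pdh (f : ℝ → ℝ → ℝ → ℝ) (a b : ℕ) : pdx (pdh a b f) = pdh (a + 1) b f := by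
  unfold pdh; rw [Function.iterate_succ_apply']

lemma SmoothXYZ.pdy_iterate_pdx {f : ℝ → ℝ → ℝ → ℝ} (hf : SmoothXYZ f) (a : ℕ) :
    _root_.pdy (_root_.pdx^[a] f) = _root_.pdx^[a] (_root_.pdy f) := by
  induction a with
  | zero => rfl
  | succ a ih =>
    rw [Function.iterate_succ_apply', (hf.iterate_pdx a).pdy_pdx, ih,
      Function.iterate_succ_apply']

lemma SmoothXYZ.pdy_pdh {f : ℝ → ℝ → ℝ → ℝ} (hf : SmoothXYZ f) (a b : ℕ) :
    _root_.pdy (_root_.pdh a b f) = _root_.pdh a (b + 1) f := by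
  unfold _root_.pdh; rw [(hf.iterate_pdy b).pdy_iterate_pdx, Function.iterate_succ_apply']

lemma intervalIntegral_hasDerivAt_param {F F' : ℝ → ℝ → ℝ}
    (hF : Continuous fun p : ℝ × ℝ => F p.1 p.2) (hF' : Continuous fun p : ℝ × ℝ => F' p.1 p.2)
    (h : ∀ x s, HasDerivAt (fun x' => F x' s) (F' x s) x) (a b x : ℝ) :
    HasDerivAt (fun x' => ∫ s in a..b, F x' s) (∫ s in a..b, F' x s) x := by
  obtain ⟨C, hC⟩ := ((isCompact_Icc (a := x - 1) (b := x + 1)).prod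
    (isCompact_uIcc (a := a) (b := b))).exists_bound_of_continuousOn hF'.continuousOn
  have hFx : ∀ x, Continuous (F x) := fun x => hF.comp (by fun_prop : Continuous fun s => (x, s))
  have hFx' : ∀ x, Continuous (F' x) := fun x =>
    hF'.comp (by fun_prop : Continuous fun s => (x, s))
  refine (intervalIntegral.hasDerivAt_integral_of_dominated_loc_of_deriv_le
    (bound := fun _ => C) (Icc_mem_nhds (by linarith : x - 1 < x) (by linarith : x < x + 1))
    (Eventually.of_forall fun x => (hFx x).aestronglyMeasurable)
    ((hFx x).intervalIntegrable _ _) (hFx' x).aestronglyMeasurable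
    (Eventually.of_forall fun s hs x' hx' => ?_) intervalIntegrable_const
    (Eventually.of_forall fun s _ x' _ => h x' s)).2
  exact hC (x', s) ⟨hx', uIoc_subset_uIcc hs⟩

/-- `L` maps smooth functions to functions whose horizontal derivatives are obtained by applying
`L` to the derivatives. -/
def CommutesHoriz (L : (ℝ → ℝ → ℝ → ℝ) → ℝ → ℝ → ℝ → ℝ) : Prop :=
  ∀ g, SmoothXYZ g → ∀ x y z,
    HasDerivAt (fun x' => L g x' y z) (L (pdx g) x y z) x ∧
    HasDerivAt (fun y' => L g x y' z) (L (pdy g) x y z) y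

lemma commutesHoriz_phiF (t : ℝ) : CommutesHoriz (phiF t) := by
  intro g hg x y z
  have hc : ∀ f, SmoothXYZ f → (Continuous fun p : ℝ × ℝ =>
      f p.1 y p.2 * Real.exp (p.2 ^ 2 / (4 * angT t))) ∧ (Continuous fun p : ℝ × ℝ =>
      f x p.1 p.2 * Real.exp (p.2 ^ 2 / (4 * angT t))) := by
    intro f hf
    constructor
    · exact (hf.continuous.comp (by fun_prop : Continuous fun p : ℝ × ℝ => (p.1, y, p.2))).mul
        (by fun_prop)
    · exact (hf.continuous.comp (by fun_prop : Continuous fun p : ℝ × ℝ => (x, p.1, p.2))).mul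
        (by fun_prop)
  constructor
  · exact (intervalIntegral_hasDerivAt_param (hc g hg).1 (hc _ hg.pdx).1
      (fun x s => (hg.hasDerivAt_x x y s).mul_const _) 0 z x).const_mul _
  · exact (intervalIntegral_hasDerivAt_param (hc g hg).2 (hc _ hg.pdy).2
      (fun y s => (hg.hasDerivAt_y x y s).mul_const _) 0 z y).const_mul _

/-- the operator `g ↦ g - z φ / (2⟨t⟩)`, which sends `g` to `u^r` -/
def urOp (t : ℝ) (g : ℝ → ℝ → ℝ → ℝ) : ℝ → ℝ → ℝ → ℝ := fun x y z =>
  g x y z - z / (2 * angT t) * phiF t g x y z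

lemma commutesHoriz_urOp (t : ℝ) : CommutesHoriz (urOp t) := fun g hg x y z =>
  ⟨(hg.hasDerivAt_x x y z).sub (((commutesHoriz_phiF t g hg x y z).1).const_mul _),
    (hg.hasDerivAt_y x y z).sub (((commutesHoriz_phiF t g hg x y z).2).const_mul _)⟩

lemma ur_eq_urOp {t : ℝ} (ht : 0 ≤ t) {g : ℝ → ℝ → ℝ → ℝ} (hg : SmoothXYZ g) :
    ur t g = urOp t g := by
  funext x y z
  have hT := angT_pos ht
  have hc : Continuous fun s => g x y s * Real.exp (s ^ 2 / (4 * angT t)) :=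
    (hg.continuous.comp (by fun_prop : Continuous fun s : ℝ => (x, y, s))).mul (by fun_prop)
  have h1 := intervalIntegral.integral_hasDerivAt_right (hc.intervalIntegrable 0 z)
    (hc.stronglyMeasurableAtFilter _ _) hc.continuousAt
  have h2 : HasDerivAt (fun z : ℝ => Real.exp (-(z ^ 2) / (4 * angT t)))
      (Real.exp (-(z ^ 2) / (4 * angT t)) * (-(2 * z) / (4 * angT t))) z := by
    have := (((hasDerivAt_pow 2 z).neg).div_const (4 * angT t)).exp
    simpa using this
  have h3 := (h2.mul h1).deriv
  have h4 : Real.exp (-(z ^ 2) / (4 * angT t)) * Real.exp (z ^ 2 / (4 * angT t)) = 1 := by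
    rw [← Real.exp_add, ← Real.exp_zero]; congr 1; ring
  have : ur t g x y z = _ := h3
  rw [this]
  unfold urOp phiF
  have h5 : -(2 * z) / (4 * angT t) = - (z / (2 * angT t)) := by field_simp; ring
  rw [h5]
  linear_combination (g x y z) * h4

lemma iterate_pdx_apply (f : ℝ → ℝ → ℝ → ℝ) (a : ℕ) (x y z : ℝ) :
    pdx^[a] f x y z = iteratedDeriv a (fun x' => f x' y z) x := by
  induction a generalizing x with
  | zero => simp
  | succ a ih =>
    rw [Function.iterate_succ_apply', iteratedDeriv_succ]
    unfold pdx
    congr 1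
    funext x'
    exact ih x'

lemma iterate_pdy_apply (f : ℝ → ℝ → ℝ → ℝ) (a : ℕ) (x y z : ℝ) :
    pdy^[a] f x y z = iteratedDeriv a (fun y' => f x y' z) y := by
  induction a generalizing y with
  | zero => simp
  | succ a ih =>
    rw [Function.iterate_succ_apply', iteratedDeriv_succ]
    unfold pdy
    congr 1
    funext y'
    exact ih y'

lemma iteratedDeriv_eq_of_hasDerivAt_seq {u : ℕ → ℝ → ℝ}
    (hu : ∀ i x, HasDerivAt (u i) (u (i + 1) x) x) (n : ℕ) : iteratedDeriv n (u 0) = u n := by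
  induction n with
  | zero => simp
  | succ n ih => rw [iteratedDeriv_succ, ih]; funext x; exact (hu n x).deriv

lemma contDiff_of_hasDerivAt_seq {u : ℕ → ℝ → ℝ}
    (hu : ∀ i x, HasDerivAt (u i) (u (i + 1) x) x) : ContDiff ℝ (⊤ : ℕ∞) (u 0) := by
  refine contDiff_of_differentiable_iteratedDeriv fun m _ => ?_
  rw [iteratedDeriv_eq_of_hasDerivAt_seq hu]
  exact fun x => (hu m x).differentiableAt

lemma iteratedDeriv_mul_of_hasDerivAt_seq {u v : ℕ → ℝ → ℝ}
    (hu : ∀ i x, HasDerivAt (u i) (u (i + 1) x) x) (hv : ∀ i x, HasDerivAt (v i) (v (i + 1) x) x)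
    (n : ℕ) (x : ℝ) : iteratedDeriv n (fun x => u 0 x * v 0 x) x =
      ∑ i ∈ Finset.range (n + 1), n.choose i * u i x * v (n - i) x := by
  have h1 : ContDiff ℝ n (u 0) := (contDiff_of_hasDerivAt_seq hu).of_le (by exact_mod_cast le_top)
  have h2 : ContDiff ℝ n (v 0) := (contDiff_of_hasDerivAt_seq hv).of_le (by exact_mod_cast le_top)
  rw [iteratedDeriv_fun_mul h1.contDiffAt h2.contDiffAt]
  simp only [iteratedDeriv_eq_of_hasDerivAt_seq hu, iteratedDeriv_eq_of_hasDerivAt_seq hv]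

lemma pdh_mul {L K : (ℝ → ℝ → ℝ → ℝ) → ℝ → ℝ → ℝ → ℝ} (hL : CommutesHoriz L)
    (hK : CommutesHoriz K) {g : ℝ → ℝ → ℝ → ℝ} (hg : SmoothXYZ g) (a b : ℕ) (x y z : ℝ) :
    pdh a b (fun x y z => L g x y z * K g x y z) x y z =
      ∑ j ∈ Finset.range (b + 1), ∑ i ∈ Finset.range (a + 1),
        (a.choose i * b.choose j : ℝ) *
          (L (pdh i j g) x y z * K (pdh (a - i) (b - j) g) x y z) := by
  have hy : ∀ {L}, CommutesHoriz L → ∀ x z i y', HasDerivAt (fun y => L (pdy^[i] g) x y z)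
      (L (pdy^[i + 1] g) x y' z) y' := by
    intro L hL x z i y'
    rw [Function.iterate_succ_apply']
    exact (hL _ (hg.iterate_pdy i) x y' z).2
  have hx : ∀ {L}, CommutesHoriz L → ∀ y z i j x', HasDerivAt (fun x => L (pdh i j g) x y z)
      (L (pdh (i + 1) j g) x' y z) x' := by
    intro L hL y z i j x'
    rw [← pdx_pdh]
    exact (hL _ (hg.pdh i j) x' y z).1
  have e : pdy^[b] (fun x y z => L g x y z * K g x y z) = fun x y z =>
      ∑ j ∈ Finset.range (b + 1),
        (b.choose j : ℝ) * (L (pdy^[j] g) x y z * K (pdy^[b - j] g) x y z) := by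
    funext x y z
    rw [iterate_pdy_apply]
    have := iteratedDeriv_mul_of_hasDerivAt_seq (hy hL x z) (hy hK x z) b y
    simp only [Function.iterate_zero, id] at this
    rw [this]
    exact Finset.sum_congr rfl fun _ _ => by ring
  unfold pdh at hx ⊢
  rw [e, iterate_pdx_apply]
  have hcd : ∀ {L}, CommutesHoriz L → ∀ j,
      ContDiff ℝ (⊤ : ℕ∞) (fun x => L (pdy^[j] g) x y z) := by
    intro L hL j
    exact contDiff_of_hasDerivAt_seq (u := fun i x => L (pdx^[i] (pdy^[j] g)) x y z)
      (fun i x => hx hL y z i j x)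
  have hle : ((a : ℕ) : WithTop ℕ∞) ≤ ((⊤ : ℕ∞) : WithTop ℕ∞) := by exact_mod_cast le_top
  rw [iteratedDeriv_fun_sum fun j _ =>
    (contDiff_const.mul ((hcd hL j).mul (hcd hK (b - j)))).contDiffAt.of_le hle]
  refine Finset.sum_congr rfl fun j _ => ?_
  rw [iteratedDeriv_const_mul_field]
  have := iteratedDeriv_mul_of_hasDerivAt_seq
    (u := fun i x => L (pdx^[i] (pdy^[j] g)) x y z)
    (v := fun i x => K (pdx^[i] (pdy^[b - j] g)) x y z)
    (fun i x => hx hL y z i j x) (fun i x => hx hK y z i (b - j) x) a x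
  simp only [Function.iterate_zero, id] at this
  rw [this, Finset.mul_sum]
  exact Finset.sum_congr rfl fun _ _ => by ring

open scoped ENNReal

lemma sq_le_intervalIntegral_unit {w w' : ℝ → ℝ} (hw : ∀ s, HasDerivAt w (w' s) s)
    (hw' : Continuous w') : w 0 ^ 2 ≤ ∫ s in (0 : ℝ)..1, (2 * w s ^ 2 + w' s ^ 2) := by
  have hwc : Continuous w := continuous_iff_continuousAt.2 fun s => (hw s).continuousAt
  have hd : ∀ s ∈ uIcc (0 : ℝ) 1, HasDerivAt (fun s => (s - 1) * w s ^ 2)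
      (w s ^ 2 + (s - 1) * (2 * w s * w' s)) s := by
    intro s _
    refine (((hasDerivAt_id s).sub_const 1).mul ((hw s).pow 2)).congr_deriv ?_
    simp
  have hc : Continuous fun s => w s ^ 2 + (s - 1) * (2 * w s * w' s) := by fun_prop
  have h := intervalIntegral.integral_eq_sub_of_hasDerivAt hd (hc.intervalIntegrable _ _)
  have h0 : w 0 ^ 2 = ∫ s in (0 : ℝ)..1, (w s ^ 2 + (s - 1) * (2 * w s * w' s)) := by
    rw [h]; ring
  rw [h0]
  refine intervalIntegral.integral_mono_on zero_le_one (hc.intervalIntegrable _ _)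
    ((by fun_prop : Continuous fun s => 2 * w s ^ 2 + w' s ^ 2).intervalIntegrable _ _) ?_
  intro s hs
  nlinarith [mul_nonneg (sub_nonneg.2 hs.2) (sq_nonneg (w s + w' s)),
    mul_nonneg hs.1 (sq_nonneg (w s)), mul_nonneg hs.1 (sq_nonneg (w' s))]

lemma enorm_sq_le_lintegral_unit {v v' : ℝ → ℝ} (hv : ∀ s, HasDerivAt v (v' s) s)
    (hv' : Continuous v') {σ : ℝ} (hσ : σ ^ 2 = 1) (x : ℝ) :
    ‖v x‖ₑ ^ 2 ≤ ∫⁻ s in Ioc (0 : ℝ) 1, (2 * ‖v (x + σ * s)‖ₑ ^ 2 + ‖v' (x + σ * s)‖ₑ ^ 2) := by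
  have hvc : Continuous v := continuous_iff_continuousAt.2 fun s => (hv s).continuousAt
  have h := sq_le_intervalIntegral_unit (w := fun s => v (x + σ * s))
    (w' := fun s => v' (x + σ * s) * σ)
    (fun s => by
      have h1 : HasDerivAt (fun s : ℝ => x + σ * s) σ s := by
        simpa using ((hasDerivAt_id s).const_mul σ).const_add x
      exact (hv (x + σ * s)).comp s h1) (by fun_prop)
  have he : ∀ r : ℝ, ‖r‖ₑ ^ 2 = ENNReal.ofReal (r ^ 2) := by
    intro r
    rw [Real.enorm_eq_ofReal_abs, ← ENNReal.ofReal_pow (abs_nonneg _), sq_abs]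
  have hint : ∀ s, 2 * ‖v (x + σ * s)‖ₑ ^ 2 + ‖v' (x + σ * s)‖ₑ ^ 2 =
      ENNReal.ofReal (2 * v (x + σ * s) ^ 2 + (v' (x + σ * s) * σ) ^ 2) := by
    intro s
    rw [mul_pow, hσ, mul_one, ENNReal.ofReal_add (by positivity) (by positivity),
      ENNReal.ofReal_mul zero_le_two, he, he, ENNReal.ofReal_ofNat]
  simp_rw [hint]
  have hc : Continuous fun s => 2 * v (x + σ * s) ^ 2 + (v' (x + σ * s) * σ) ^ 2 := by fun_prop
  rw [← ofReal_integral_eq_lintegral_ofReal (hc.integrableOn_Ioc)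
    (Eventually.of_forall fun s => by positivity), he]
  rw [intervalIntegral.integral_of_le zero_le_one] at h
  simpa using ENNReal.ofReal_le_ofReal h

/-- squared weighted `L²_z` norm at fixed `(x, y)` -/
def zNormSq (t : ℝ) (f : ℝ → ℝ → ℝ → ℝ) (x y : ℝ) : ℝ≥0∞ :=
  ∫⁻ z in Ioi (0 : ℝ), ‖thw t 1 z * f x y z‖ₑ ^ 2

/-- squared weighted `L²` norm -/
def normSq (t : ℝ) (n : ℕ) (f : ℝ → ℝ → ℝ → ℝ) : ℝ≥0∞ :=
  ∫⁻ x : ℝ, ∫⁻ y : ℝ, ENNReal.ofReal (angR x y) ^ (2 * n) * zNormSq t f x y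

@[fun_prop]
lemma continuous_thw (t lam : ℝ) : Continuous (thw t lam) := by unfold thw; fun_prop

lemma continuous_angR : Continuous fun p : ℝ × ℝ => angR p.1 p.2 := by unfold angR; fun_prop

lemma one_le_angR (x y : ℝ) : 1 ≤ angR x y := by
  unfold angR; rw [Real.one_le_sqrt]; nlinarith [sq_nonneg x, sq_nonneg y]

lemma thw_pos (t lam z : ℝ) : 0 < thw t lam z := Real.exp_pos _

lemma SmoothXYZ.measurable_integrand {α : Type*} [MeasurableSpace α] {f : ℝ → ℝ → ℝ → ℝ}
    (hf : SmoothXYZ f) (t : ℝ) {u v w : α → ℝ} (hu : Measurable u) (hv : Measurable v)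
    (hw : Measurable w) : Measurable fun p => ‖thw t 1 (w p) * f (u p) (v p) (w p)‖ₑ ^ 2 := by
  have h1 : Measurable fun p => f (u p) (v p) (w p) :=
    hf.continuous.measurable.comp (hu.prodMk (hv.prodMk hw))
  have h2 : Measurable fun p => thw t 1 (w p) := (continuous_thw t 1).measurable.comp hw
  exact (h2.mul h1).enorm.pow_const 2

lemma SmoothXYZ.measurable_zNormSq {α : Type*} [MeasurableSpace α] {f : ℝ → ℝ → ℝ → ℝ}
    (hf : SmoothXYZ f) (t : ℝ) {u v : α → ℝ} (hu : Measurable u) (hv : Measurable v) :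
    Measurable fun p => zNormSq t f (u p) (v p) :=
  (hf.measurable_integrand t (hu.comp measurable_fst) (hv.comp measurable_fst)
    measurable_snd).lintegral_prod_right'

lemma SmoothXYZ.zNormSq_le_x {f : ℝ → ℝ → ℝ → ℝ} (hf : SmoothXYZ f) (t : ℝ)
    {σ : ℝ} (hσ : σ ^ 2 = 1) (x y : ℝ) :
    zNormSq t f x y ≤ ∫⁻ s in Ioc (0 : ℝ) 1,
      (2 * zNormSq t f (x + σ * s) y + zNormSq t (_root_.pdx f) (x + σ * s) y) := by
  calc zNormSq t f x y
      ≤ ∫⁻ z in Ioi (0 : ℝ), ∫⁻ s in Ioc (0 : ℝ) 1,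
        (2 * ‖thw t 1 z * f (x + σ * s) y z‖ₑ ^ 2 +
          ‖thw t 1 z * _root_.pdx f (x + σ * s) y z‖ₑ ^ 2) := by
        refine lintegral_mono fun z => ?_
        refine enorm_sq_le_lintegral_unit (v := fun x => thw t 1 z * f x y z)
          (v' := fun x => thw t 1 z * _root_.pdx f x y z)
          (fun x => (hf.hasDerivAt_x x y z).const_mul _) ?_ hσ x
        exact continuous_const.mul
          (hf.pdx.continuous.comp (by fun_prop : Continuous fun x : ℝ => (x, y, z)))
    _ = ∫⁻ s in Ioc (0 : ℝ) 1, ∫⁻ z in Ioi (0 : ℝ),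
        (2 * ‖thw t 1 z * f (x + σ * s) y z‖ₑ ^ 2 +
          ‖thw t 1 z * _root_.pdx f (x + σ * s) y z‖ₑ ^ 2) := by
        refine lintegral_lintegral_swap (Measurable.aemeasurable ?_)
        exact Measurable.add (Measurable.const_mul (hf.measurable_integrand t
          (by fun_prop) measurable_const measurable_fst) 2) (hf.pdx.measurable_integrand t
          (by fun_prop) measurable_const measurable_fst)
    _ = _ := by
        refine lintegral_congr fun s => ?_
        have h1 : Measurable fun z : ℝ => ‖thw t 1 z * f (x + σ * s) y z‖ₑ ^ 2 :=
          hf.measurable_integrand t measurable_const measurable_const measurable_id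
        rw [lintegral_add_left (h1.const_mul 2), lintegral_const_mul _ h1]
        rfl

lemma SmoothXYZ.zNormSq_le_y {f : ℝ → ℝ → ℝ → ℝ} (hf : SmoothXYZ f) (t : ℝ)
    {σ : ℝ} (hσ : σ ^ 2 = 1) (x y : ℝ) :
    zNormSq t f x y ≤ ∫⁻ s in Ioc (0 : ℝ) 1,
      (2 * zNormSq t f x (y + σ * s) + zNormSq t (_root_.pdy f) x (y + σ * s)) := by
  calc zNormSq t f x y
      ≤ ∫⁻ z in Ioi (0 : ℝ), ∫⁻ s in Ioc (0 : ℝ) 1,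
        (2 * ‖thw t 1 z * f x (y + σ * s) z‖ₑ ^ 2 +
          ‖thw t 1 z * _root_.pdy f x (y + σ * s) z‖ₑ ^ 2) := by
        refine lintegral_mono fun z => ?_
        refine enorm_sq_le_lintegral_unit (v := fun y => thw t 1 z * f x y z)
          (v' := fun y => thw t 1 z * _root_.pdy f x y z)
          (fun y => (hf.hasDerivAt_y x y z).const_mul _) ?_ hσ y
        exact continuous_const.mul
          (hf.pdy.continuous.comp (by fun_prop : Continuous fun y : ℝ => (x, y, z)))
    _ = ∫⁻ s in Ioc (0 : ℝ) 1, ∫⁻ z in Ioi (0 : ℝ),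
        (2 * ‖thw t 1 z * f x (y + σ * s) z‖ₑ ^ 2 +
          ‖thw t 1 z * _root_.pdy f x (y + σ * s) z‖ₑ ^ 2) := by
        refine lintegral_lintegral_swap (Measurable.aemeasurable ?_)
        exact Measurable.add (Measurable.const_mul (hf.measurable_integrand t
          measurable_const (by fun_prop) measurable_fst) 2) (hf.pdy.measurable_integrand t
          measurable_const (by fun_prop) measurable_fst)
    _ = _ := by
        refine lintegral_congr fun s => ?_
        have h1 : Measurable fun z : ℝ => ‖thw t 1 z * f x (y + σ * s) z‖ₑ ^ 2 :=
          hf.measurable_integrand t measurable_const measurable_const measurable_id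
        rw [lintegral_add_left (h1.const_mul 2), lintegral_const_mul _ h1]
        rfl

lemma lintegral_Ioc_affine_le (F : ℝ → ℝ≥0∞) {σ : ℝ} (hσ : σ ^ 2 = 1) (x : ℝ) :
    ∫⁻ s in Ioc (0 : ℝ) 1, F (x + σ * s) ≤ ∫⁻ s, F s := by
  refine (setLIntegral_le_lintegral _ _).trans_eq ?_
  rcases eq_or_eq_neg_of_sq_eq_sq σ 1 (by rw [hσ, one_pow]) with rfl | rfl
  · simpa using lintegral_add_left_eq_self F x
  · simpa [sub_eq_add_neg] using lintegral_sub_left_eq_self F x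

lemma exists_outward_sign (x : ℝ) : ∃ σ : ℝ, σ ^ 2 = 1 ∧ ∀ s, 0 ≤ s → x ^ 2 ≤ (x + σ * s) ^ 2 := by
  rcases le_total 0 x with h | h
  · exact ⟨1, by norm_num, fun s hs => by nlinarith⟩
  · exact ⟨-1, by norm_num, fun s hs => by nlinarith⟩

lemma angR_mono {x y x' y' : ℝ} (hx : x ^ 2 ≤ x' ^ 2) (hy : y ^ 2 ≤ y' ^ 2) :
    angR x y ≤ angR x' y' := Real.sqrt_le_sqrt (by linarith)

lemma lintegral_four_two_two_one {α : Type*} [MeasurableSpace α] (μ : Measure α)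
    {A B C D : α → ℝ≥0∞} (hA : Measurable A) (hB : Measurable B) (hC : Measurable C) :
    ∫⁻ a, (4 * A a + 2 * B a + 2 * C a + D a) ∂μ =
      4 * ∫⁻ a, A a ∂μ + 2 * ∫⁻ a, B a ∂μ + 2 * ∫⁻ a, C a ∂μ + ∫⁻ a, D a ∂μ := by
  have h1 : Measurable fun a => 4 * A a + 2 * B a := (hA.const_mul 4).add (hB.const_mul 2)
  have h2 : Measurable fun a => 4 * A a + 2 * B a + 2 * C a := h1.add (hC.const_mul 2)
  rw [lintegral_add_left h2, lintegral_add_left h1,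
    lintegral_add_left (hA.const_mul 4), lintegral_const_mul _ hA, lintegral_const_mul _ hB,
    lintegral_const_mul _ hC]

/-- The Sobolev embedding from one-dimensional averaging inequalities in `x` and in `y`. -/
lemma weight_mul_le_of_unit_averages {W A B C D : ℝ → ℝ → ℝ≥0∞}
    (hW : ∀ x y, W x y ≠ ∞)
    (hWm : Measurable fun p : ℝ × ℝ => W p.1 p.2)
    (hWle : ∀ {x y x' y' : ℝ}, x ^ 2 ≤ x' ^ 2 → y ^ 2 ≤ y' ^ 2 → W x y ≤ W x' y')
    (hA : Measurable fun p : ℝ × ℝ => A p.1 p.2) (hB : Measurable fun p : ℝ × ℝ => B p.1 p.2)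
    (hC : Measurable fun p : ℝ × ℝ => C p.1 p.2)
    (hAx : ∀ σ : ℝ, σ ^ 2 = 1 → ∀ x y,
      A x y ≤ ∫⁻ s in Ioc (0 : ℝ) 1, (2 * A (x + σ * s) y + B (x + σ * s) y))
    (hAy : ∀ σ : ℝ, σ ^ 2 = 1 → ∀ x y,
      A x y ≤ ∫⁻ s in Ioc (0 : ℝ) 1, (2 * A x (y + σ * s) + C x (y + σ * s)))
    (hBy : ∀ σ : ℝ, σ ^ 2 = 1 → ∀ x y,
      B x y ≤ ∫⁻ s in Ioc (0 : ℝ) 1, (2 * B x (y + σ * s) + D x (y + σ * s)))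
    (x y : ℝ) :
    W x y * A x y ≤ 4 * (∫⁻ x, ∫⁻ y, W x y * A x y) + 2 * (∫⁻ x, ∫⁻ y, W x y * B x y) +
      2 * (∫⁻ x, ∫⁻ y, W x y * C x y) + ∫⁻ x, ∫⁻ y, W x y * D x y := by
  obtain ⟨σ, hσ, hx⟩ := exists_outward_sign x
  obtain ⟨ρ, hρ, hy⟩ := exists_outward_sign y
  let G : ℝ → ℝ → ℝ≥0∞ := fun x y =>
    4 * (W x y * A x y) + 2 * (W x y * B x y) + 2 * (W x y * C x y) + W x y * D x y
  have step : ∀ s ∈ Ioc (0 : ℝ) 1, W x y * (2 * A (x + σ * s) y + B (x + σ * s) y) ≤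
      ∫⁻ r in Ioc (0 : ℝ) 1, G (x + σ * s) (y + ρ * r) := by
    intro s hs
    have hmy : ∀ {f : ℝ → ℝ → ℝ≥0∞}, (Measurable fun p : ℝ × ℝ => f p.1 p.2) →
        Measurable fun r : ℝ => f (x + σ * s) (y + ρ * r) :=
      fun hf => hf.comp (by fun_prop : Measurable fun r : ℝ => (x + σ * s, y + ρ * r))
    have a1 : Measurable fun r : ℝ =>
        2 * A (x + σ * s) (y + ρ * r) + C (x + σ * s) (y + ρ * r) :=
      ((hmy hA).const_mul 2).add (hmy hC)
    calc _ ≤ W x y * (2 * (∫⁻ r in Ioc (0 : ℝ) 1,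
            (2 * A (x + σ * s) (y + ρ * r) + C (x + σ * s) (y + ρ * r))) +
          ∫⁻ r in Ioc (0 : ℝ) 1, (2 * B (x + σ * s) (y + ρ * r) +
            D (x + σ * s) (y + ρ * r))) := by
          gcongr
          · exact hAy _ hρ _ _
          · exact hBy _ hρ _ _
      _ = ∫⁻ r in Ioc (0 : ℝ) 1, W x y *
          (2 * (2 * A (x + σ * s) (y + ρ * r) + C (x + σ * s) (y + ρ * r)) +
          (2 * B (x + σ * s) (y + ρ * r) + D (x + σ * s) (y + ρ * r))) := by
          rw [lintegral_const_mul' _ _ (hW x y), lintegral_add_left (a1.const_mul 2),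
            lintegral_const_mul _ a1]
      _ ≤ _ := by
          refine setLIntegral_mono' measurableSet_Ioc fun r hr => ?_
          have hle : W x y ≤ W (x + σ * s) (y + ρ * r) := hWle (hx s hs.1.le) (hy r hr.1.le)
          refine (mul_le_mul_left hle _).trans_eq ?_
          simp only [G]
          ring
  calc _ ≤ W x y * ∫⁻ s in Ioc (0 : ℝ) 1, (2 * A (x + σ * s) y + B (x + σ * s) y) := by
        gcongr; exact hAx _ hσ x y
    _ ≤ ∫⁻ s in Ioc (0 : ℝ) 1, ∫⁻ r in Ioc (0 : ℝ) 1, G (x + σ * s) (y + ρ * r) := by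
        rw [← lintegral_const_mul' _ _ (hW x y)]
        exact setLIntegral_mono' measurableSet_Ioc step
    _ ≤ ∫⁻ s in Ioc (0 : ℝ) 1, ∫⁻ y', G (x + σ * s) y' :=
        lintegral_mono fun s => lintegral_Ioc_affine_le (G (x + σ * s)) hρ y
    _ ≤ ∫⁻ x', ∫⁻ y', G x' y' := lintegral_Ioc_affine_le (fun x' => ∫⁻ y', G x' y') hσ x
    _ = _ := by
        have hm1 : ∀ {f : ℝ → ℝ → ℝ≥0∞}, (Measurable fun p : ℝ × ℝ => f p.1 p.2) →
            ∀ x', Measurable fun y' : ℝ => W x' y' * f x' y' :=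
          fun hf x' => (hWm.mul hf).comp measurable_prodMk_left
        have hm2 : ∀ {f : ℝ → ℝ → ℝ≥0∞}, (Measurable fun p : ℝ × ℝ => f p.1 p.2) →
            Measurable fun x' : ℝ => ∫⁻ y', W x' y' * f x' y' :=
          fun hf => (hWm.mul hf).lintegral_prod_right'
        simp only [G]
        simp_rw [fun x' => lintegral_four_two_two_one volume (D := fun y' => W x' y' * D x' y')
          (hm1 hA x') (hm1 hB x') (hm1 hC x')]
        exact lintegral_four_two_two_one volume (hm2 hA) (hm2 hB) (hm2 hC)

/-- Sobolev embedding `H²_h ⊂ L^∞_h`, with the weights `⟨r⟩ⁿ` at no cost. -/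
lemma SmoothXYZ.weight_mul_zNormSq_le {f : ℝ → ℝ → ℝ → ℝ} (hf : SmoothXYZ f) (t : ℝ) (n : ℕ)
    (x y : ℝ) :
    ENNReal.ofReal (angR x y) ^ (2 * n) * zNormSq t f x y ≤
      4 * normSq t n f + 2 * normSq t n (_root_.pdx f) + 2 * normSq t n (_root_.pdy f) +
        normSq t n (_root_.pdy (_root_.pdx f)) :=
  weight_mul_le_of_unit_averages
    (W := fun x y => ENNReal.ofReal (angR x y) ^ (2 * n)) (A := zNormSq t f)
    (B := zNormSq t (_root_.pdx f)) (C := zNormSq t (_root_.pdy f))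
    (D := zNormSq t (_root_.pdy (_root_.pdx f)))
    (fun _ _ => ENNReal.pow_ne_top ENNReal.ofReal_ne_top)
    ((continuous_angR.measurable.ennreal_ofReal).pow_const _)
    (fun hx hy => pow_le_pow_left' (ENNReal.ofReal_le_ofReal (angR_mono hx hy)) _)
    (hf.measurable_zNormSq t measurable_fst measurable_snd)
    (hf.pdx.measurable_zNormSq t measurable_fst measurable_snd)
    (hf.pdy.measurable_zNormSq t measurable_fst measurable_snd)
    (fun _ hσ => hf.zNormSq_le_x t hσ) (fun _ hσ => hf.zNormSq_le_y t hσ)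
    (fun _ hσ => hf.pdx.zNormSq_le_y t hσ) x y

lemma ofReal_L2w_sq {t : ℝ} {n : ℕ} {f : ℝ → ℝ → ℝ → ℝ}
    (hI : Integrable (fun p : ℝ × ℝ × ℝ => (thw t 1 p.2.2 * angR p.1 p.2.1 ^ n *
      f p.1 p.2.1 p.2.2) ^ 2) (volume.restrict {p : ℝ × ℝ × ℝ | 0 < p.2.2})) :
    ENNReal.ofReal (L2w t 1 n f) ^ 2 = normSq t n f := by
  have hμ : (volume.restrict {p : ℝ × ℝ × ℝ | 0 < p.2.2} : Measure (ℝ × ℝ × ℝ)) =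
      (volume : Measure ℝ).prod ((volume : Measure ℝ).prod (volume.restrict (Ioi (0 : ℝ)))) := by
    have hs : {p : ℝ × ℝ × ℝ | 0 < p.2.2} = univ ×ˢ (univ ×ˢ Ioi (0 : ℝ)) := by
      ext p; simp
    rw [hs, Measure.volume_eq_prod, ← Measure.prod_restrict, Measure.volume_eq_prod,
      ← Measure.prod_restrict, Measure.restrict_univ]
  rw [hμ] at hI
  have h1 : ∫ x : ℝ, ∫ y : ℝ, ∫ z in Ioi (0 : ℝ), (thw t 1 z * angR x y ^ n * f x y z) ^ 2 =
      ∫ p, (thw t 1 p.2.2 * angR p.1 p.2.1 ^ n * f p.1 p.2.1 p.2.2) ^ 2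
        ∂((volume : Measure ℝ).prod
          ((volume : Measure ℝ).prod (volume.restrict (Ioi (0 : ℝ))))) := by
    rw [integral_prod _ hI]
    refine integral_congr_ae ?_
    filter_upwards [hI.prod_right_ae] with x hx
    rw [integral_prod _ hx]
  have h2 : ENNReal.ofReal (∫ p, (thw t 1 p.2.2 * angR p.1 p.2.1 ^ n * f p.1 p.2.1 p.2.2) ^ 2
        ∂((volume : Measure ℝ).prod
          ((volume : Measure ℝ).prod (volume.restrict (Ioi (0 : ℝ)))))) = normSq t n f := by
    rw [ofReal_integral_eq_lintegral_ofReal hI (Eventually.of_forall fun p => by positivity),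
      lintegral_prod _ hI.aestronglyMeasurable.aemeasurable.ennreal_ofReal]
    unfold normSq
    refine lintegral_congr_ae ?_
    filter_upwards [hI.prod_right_ae] with x hx
    rw [lintegral_prod _ hx.aestronglyMeasurable.aemeasurable.ennreal_ofReal]
    refine lintegral_congr fun y => ?_
    unfold zNormSq
    rw [← lintegral_const_mul' _ _ (ENNReal.pow_ne_top ENNReal.ofReal_ne_top)]
    refine lintegral_congr fun z => ?_
    have : 0 ≤ angR x y := zero_le_one.trans (one_le_angR x y)
    rw [Real.enorm_eq_ofReal_abs, ← ENNReal.ofReal_pow (abs_nonneg _), sq_abs,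
      ← ENNReal.ofReal_pow this, ← ENNReal.ofReal_mul (by positivity)]
    congr 1
    ring
  rw [L2w, ← ENNReal.ofReal_pow (Real.sqrt_nonneg _), Real.sq_sqrt, h1, h2]
  rw [h1]
  exact integral_nonneg fun p => by positivity

lemma ENNReal.sq_rpow_half (a : ℝ≥0∞) : (a ^ 2) ^ (1 / 2 : ℝ) = a := by
  rw [← ENNReal.rpow_natCast, ← ENNReal.rpow_mul]; norm_num

lemma ENNReal.rpow_half_sq (a : ℝ≥0∞) : (a ^ (1 / 2 : ℝ)) ^ 2 = a := by
  rw [← ENNReal.rpow_natCast, ← ENNReal.rpow_mul]; norm_num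

lemma lintegral_mul_le_sqrt_mul_sqrt {α : Type*} [MeasurableSpace α] (μ : Measure α)
    {f g : α → ℝ≥0∞} (hf : AEMeasurable f μ) (hg : AEMeasurable g μ) :
    ∫⁻ a, f a * g a ∂μ ≤ (∫⁻ a, f a ^ 2 ∂μ) ^ (1 / 2 : ℝ) * (∫⁻ a, g a ^ 2 ∂μ) ^ (1 / 2 : ℝ) := by
  have := ENNReal.lintegral_mul_le_Lp_mul_Lq μ Real.HolderConjugate.two_two hf hg
  simpa only [ENNReal.rpow_ofNat, Pi.mul_apply] using this

/-- weighted `L²_z` norm at fixed `(x, y)` -/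
def zNorm (t : ℝ) (f : ℝ → ℝ → ℝ → ℝ) (x y : ℝ) : ℝ≥0∞ := zNormSq t f x y ^ (1 / 2 : ℝ)

lemma zNorm_sq (t : ℝ) (f : ℝ → ℝ → ℝ → ℝ) (x y : ℝ) : zNorm t f x y ^ 2 = zNormSq t f x y :=
  ENNReal.rpow_half_sq _

lemma SmoothXYZ.measurable_zNorm {α : Type*} [MeasurableSpace α] {f : ℝ → ℝ → ℝ → ℝ}
    (hf : SmoothXYZ f) (t : ℝ) {u v : α → ℝ} (hu : Measurable u) (hv : Measurable v) :
    Measurable fun p => zNorm t f (u p) (v p) :=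
  (hf.measurable_zNormSq t hu hv).pow_const _

lemma SmoothXYZ.continuous_z {f : ℝ → ℝ → ℝ → ℝ} (hf : SmoothXYZ f) (x y : ℝ) :
    Continuous (f x y) := hf.continuous.comp (by fun_prop : Continuous fun z : ℝ => (x, y, z))

lemma SmoothXYZ.continuous_phiF {f : ℝ → ℝ → ℝ → ℝ} (hf : SmoothXYZ f) (t x y : ℝ) :
    Continuous (phiF t f x y) := by
  have h : Continuous fun s => f x y s * Real.exp (s ^ 2 / (4 * angT t)) :=
    (hf.continuous_z x y).mul (by fun_prop)
  exact (by fun_prop : Continuous fun z : ℝ => Real.exp (-(z ^ 2) / (4 * angT t))).mul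
    (intervalIntegral.continuous_primitive (fun a b => h.intervalIntegrable a b) 0)

lemma SmoothXYZ.continuous_urOp {f : ℝ → ℝ → ℝ → ℝ} (hf : SmoothXYZ f) (t x y : ℝ) :
    Continuous (urOp t f x y) :=
  (hf.continuous_z x y).sub
    ((by fun_prop : Continuous fun z : ℝ => z / (2 * angT t)).mul (hf.continuous_phiF t x y))

/-- pointwise bound of `θ φ` by the weighted `L²_z` norm of `g` -/
lemma SmoothXYZ.enorm_thw_mul_phiF_le {f : ℝ → ℝ → ℝ → ℝ} (hf : SmoothXYZ f) {t : ℝ}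
    (ht : 0 ≤ t) (x y : ℝ) {z : ℝ} (hz : 0 ≤ z) :
    ‖thw t 1 z * phiF t f x y z‖ₑ ≤ ENNReal.ofReal (√z) * zNorm t f x y := by
  have hT := angT_pos ht
  have hm : Measurable fun s => ‖thw t 1 s * f x y s‖ₑ :=
    ((continuous_thw t 1).mul (hf.continuous_z x y)).measurable.enorm
  have e : thw t 1 z * phiF t f x y z = ∫ s in Ioc 0 z,
      (thw t 1 z * Real.exp (-(z ^ 2) / (4 * angT t))) *
        (f x y s * Real.exp (s ^ 2 / (4 * angT t))) := by
    unfold phiF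
    rw [intervalIntegral.integral_of_le hz, integral_const_mul, mul_assoc]
  rw [e]
  refine (enorm_integral_le_lintegral_enorm _).trans ?_
  have hle : ∀ s ∈ Ioc 0 z, ‖(thw t 1 z * Real.exp (-(z ^ 2) / (4 * angT t))) *
        (f x y s * Real.exp (s ^ 2 / (4 * angT t)))‖ₑ ≤ ‖thw t 1 s * f x y s‖ₑ * 1 := by
    intro s hs
    rw [mul_one]
    rw [Real.enorm_eq_ofReal_abs, Real.enorm_eq_ofReal_abs]
    refine ENNReal.ofReal_le_ofReal ?_
    have h1 : thw t 1 z * Real.exp (-(z ^ 2) / (4 * angT t)) * Real.exp (s ^ 2 / (4 * angT t)) ≤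
        thw t 1 s := by
      unfold thw
      rw [← Real.exp_add, ← Real.exp_add, Real.exp_le_exp, ← sub_nonneg]
      have : 1 * s ^ 2 / (8 * angT t) - (1 * z ^ 2 / (8 * angT t) + -z ^ 2 / (4 * angT t) +
          s ^ 2 / (4 * angT t)) = (z ^ 2 - s ^ 2) / (8 * angT t) := by
        field_simp; ring
      rw [this]
      have : s ^ 2 ≤ z ^ 2 := pow_le_pow_left₀ hs.1.le hs.2 2
      exact div_nonneg (by linarith) (by positivity)
    have h2 : 0 ≤ thw t 1 z * Real.exp (-(z ^ 2) / (4 * angT t)) *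
        Real.exp (s ^ 2 / (4 * angT t)) := by
      have := (thw_pos t 1 z).le; positivity
    calc _ = |(thw t 1 z * Real.exp (-(z ^ 2) / (4 * angT t)) *
        Real.exp (s ^ 2 / (4 * angT t))) * f x y s| := by congr 1; ring
      _ ≤ _ := by
        rw [abs_mul _ (f x y s), abs_of_nonneg h2, abs_mul _ (f x y s), abs_of_pos (thw_pos t 1 s)]
        gcongr
  calc _ ≤ ∫⁻ s in Ioc 0 z, ‖thw t 1 s * f x y s‖ₑ * 1 :=
        setLIntegral_mono' measurableSet_Ioc hle
    _ ≤ (∫⁻ s in Ioc 0 z, ‖thw t 1 s * f x y s‖ₑ ^ 2) ^ (1 / 2 : ℝ) *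
        (∫⁻ _ in Ioc 0 z, (1 : ℝ≥0∞) ^ 2) ^ (1 / 2 : ℝ) :=
        lintegral_mul_le_sqrt_mul_sqrt _ hm.aemeasurable aemeasurable_const
    _ ≤ zNorm t f x y * ENNReal.ofReal (√z) := by
        gcongr
        · unfold zNorm zNormSq
          gcongr
          exact Ioc_subset_Ioi_self
        · simp [Real.sqrt_eq_rpow, ENNReal.ofReal_rpow_of_nonneg hz]
    _ = _ := mul_comm _ _

lemma mul_exp_neg_le_factorial (n : ℕ) {v : ℝ} (hv : 0 ≤ v) :
    v ^ n * Real.exp (-v) ≤ n.factorial := by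
  rw [Real.exp_neg, ← div_eq_mul_inv, div_le_iff₀ (Real.exp_pos _)]
  have := Real.pow_div_factorial_le_exp v hv n
  rwa [div_le_iff₀ (by positivity), mul_comm] at this

lemma rpow_mul_inv_thw_le {t : ℝ} (ht : 0 ≤ t) {z : ℝ} (hz : 0 ≤ z) :
    z * √z / angT t * (thw t 1 z)⁻¹ ≤ 9 := by
  have hT : 1 ≤ angT t := by unfold angT; linarith
  have hT0 := angT_pos ht
  have hθ : (thw t 1 z)⁻¹ = Real.exp (-(z ^ 2 / (8 * angT t))) := by
    unfold thw; rw [one_mul, Real.exp_neg]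
  have hv : 0 ≤ z ^ 2 / (8 * angT t) := by positivity
  have h1 := mul_exp_neg_le_factorial 1 hv
  have h0 := mul_exp_neg_le_factorial 0 hv
  norm_num at h0 h1
  have h2 : z * √z ≤ 1 + z ^ 2 := by
    have := Real.sq_sqrt hz
    nlinarith [sq_nonneg (√z - 1), Real.sqrt_nonneg z]
  have h3 : z * √z / angT t ≤ 1 + 8 * (z ^ 2 / (8 * angT t)) := by
    rw [div_le_iff₀ hT0]
    have : (1 + 8 * (z ^ 2 / (8 * angT t))) * angT t = angT t + z ^ 2 := by field_simp
    linarith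
  rw [hθ]
  calc _ ≤ (1 + 8 * (z ^ 2 / (8 * angT t))) * Real.exp (-(z ^ 2 / (8 * angT t))) := by gcongr
    _ ≤ 9 := by
      have : Real.exp (-(z ^ 2 / (8 * angT t))) ≤ 1 := by rw [Real.exp_le_one_iff]; linarith
      nlinarith

lemma sq_cube_mul_inv_thw_le {t : ℝ} (ht : 0 ≤ t) (z : ℝ) :
    (z ^ 3 / (2 * angT t ^ 2) * (thw t 1 z)⁻¹) ^ 2 ≤ 1632 * (1 + z ^ 2)⁻¹ := by
  have hT : 1 ≤ angT t := by unfold angT; linarith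
  have hT0 := angT_pos ht
  set v := z ^ 2 / (4 * angT t) with hvd
  have hv : 0 ≤ v := by positivity
  have hθ : ((thw t 1 z)⁻¹) ^ 2 = Real.exp (-v) := by
    unfold thw; rw [← Real.exp_neg, ← Real.exp_nat_mul]; congr 1; rw [hvd]; field_simp; ring
  have h3 := mul_exp_neg_le_factorial 3 hv
  have h4 := mul_exp_neg_le_factorial 4 hv
  norm_num [Nat.factorial] at h3 h4
  have hz : z ^ 2 = 4 * angT t * v := by rw [hvd]; field_simp
  rw [mul_pow, hθ, ← div_eq_mul_inv, le_div_iff₀ (by positivity)]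
  have h5 : (z ^ 3 / (2 * angT t ^ 2)) ^ 2 * (1 + z ^ 2) ≤ 16 * v ^ 3 * (1 + 4 * v) := by
    have e : (z ^ 3 / (2 * angT t ^ 2)) ^ 2 = 16 * v ^ 3 / angT t := by
      rw [div_pow, show (z ^ 3) ^ 2 = (z ^ 2) ^ 3 by ring, hz]
      field_simp
      ring
    rw [e, hz, div_mul_eq_mul_div, div_le_iff₀ hT0, mul_assoc (16 * v ^ 3)]
    gcongr
    nlinarith
  calc _ = (z ^ 3 / (2 * angT t ^ 2)) ^ 2 * (1 + z ^ 2) * Real.exp (-v) := by ring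
    _ ≤ 16 * v ^ 3 * (1 + 4 * v) * Real.exp (-v) := by gcongr
    _ ≤ _ := by nlinarith

lemma lintegral_sq_cube_mul_inv_thw_le {t : ℝ} (ht : 0 ≤ t) :
    (∫⁻ z in Ioi (0 : ℝ), ENNReal.ofReal (z ^ 3 / (2 * angT t ^ 2) * (thw t 1 z)⁻¹) ^ 2) ^
      (1 / 2 : ℝ) ≤ 60 := by
  have h : ∫⁻ z in Ioi (0 : ℝ), ENNReal.ofReal (z ^ 3 / (2 * angT t ^ 2) * (thw t 1 z)⁻¹) ^ 2 ≤
      60 ^ 2 := by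
    calc _ ≤ ∫⁻ z in Ioi (0 : ℝ), ENNReal.ofReal (1632 * (1 + z ^ 2)⁻¹) := by
          refine setLIntegral_mono' measurableSet_Ioi fun z hz => ?_
          have hz0 : (0 : ℝ) < z := hz
          have := thw_pos t 1 z
          rw [← ENNReal.ofReal_pow (by positivity)]
          exact ENNReal.ofReal_le_ofReal (sq_cube_mul_inv_thw_le ht z)
      _ = ENNReal.ofReal (1632 * (Real.pi / 2)) := by
          rw [← ofReal_integral_eq_lintegral_ofReal
            (integrable_inv_one_add_sq.integrableOn.const_mul _)
            (Eventually.of_forall fun z => by positivity), integral_const_mul,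
            integral_Ioi_inv_one_add_sq]
          simp
      _ ≤ ENNReal.ofReal (60 ^ 2) := by
          refine ENNReal.ofReal_le_ofReal ?_
          nlinarith [Real.pi_lt_d2]
      _ = 60 ^ 2 := by norm_num
  exact (ENNReal.rpow_le_rpow h (by norm_num)).trans_eq (ENNReal.sq_rpow_half _)

/-- the trilinear estimate in the vertical variable -/
lemma lintegral_vertical_le {f₁ f₂ f₃ : ℝ → ℝ → ℝ → ℝ} (h₁ : SmoothXYZ f₁) (h₂ : SmoothXYZ f₂)
    (h₃ : SmoothXYZ f₃) {t : ℝ} (ht : 0 ≤ t) (x y : ℝ) :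
    ∫⁻ z in Ioi (0 : ℝ),
      ‖1 / angT t * (z * thw t 2 z * (urOp t f₁ x y z * phiF t f₂ x y z) * f₃ x y z)‖ₑ ≤
      69 * (zNorm t f₁ x y * zNorm t f₂ x y * zNorm t f₃ x y) := by
  have hT := angT_pos ht
  have hm : ∀ {f}, SmoothXYZ f → Measurable fun z => ‖thw t 1 z * f x y z‖ₑ := fun hf =>
    ((continuous_thw t 1).mul (hf.continuous_z x y)).measurable.enorm
  have hk : Measurable fun z => ENNReal.ofReal (z ^ 3 / (2 * angT t ^ 2) * (thw t 1 z)⁻¹) :=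
    ((by fun_prop : Measurable fun z : ℝ => z ^ 3 / (2 * angT t ^ 2)).mul
      (continuous_thw t 1).measurable.inv).ennreal_ofReal
  have hpt : ∀ z ∈ Ioi (0 : ℝ),
      ‖1 / angT t * (z * thw t 2 z * (urOp t f₁ x y z * phiF t f₂ x y z) * f₃ x y z)‖ₑ ≤
      9 * zNorm t f₂ x y * (‖thw t 1 z * f₁ x y z‖ₑ * ‖thw t 1 z * f₃ x y z‖ₑ) +
      zNorm t f₁ x y * zNorm t f₂ x y *
        (ENNReal.ofReal (z ^ 3 / (2 * angT t ^ 2) * (thw t 1 z)⁻¹) *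
          ‖thw t 1 z * f₃ x y z‖ₑ) := by
    intro z hz
    have hz0 : (0 : ℝ) < z := hz
    have hθ := thw_pos t 1 z
    have hθ2 : thw t 2 z = thw t 1 z ^ 2 := by
      unfold thw; rw [← Real.exp_nat_mul]; congr 1; push_cast; ring
    have e : 1 / angT t * (z * thw t 2 z * (urOp t f₁ x y z * phiF t f₂ x y z) * f₃ x y z) =
        (z / angT t * (thw t 1 z)⁻¹) * (thw t 1 z * phiF t f₂ x y z) * (thw t 1 z * f₁ x y z) *
          (thw t 1 z * f₃ x y z) +
        -((z ^ 2 / (2 * angT t ^ 2) * (thw t 1 z)⁻¹) * (thw t 1 z * phiF t f₁ x y z) *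
          (thw t 1 z * phiF t f₂ x y z) * (thw t 1 z * f₃ x y z)) := by
      rw [hθ2]; unfold urOp; field_simp; ring
    rw [e]
    refine (enorm_add_le _ _).trans ?_
    rw [enorm_neg]
    simp only [enorm_mul _ (thw t 1 z * f₃ x y z), enorm_mul _ (thw t 1 z * f₁ x y z),
      enorm_mul _ (thw t 1 z * phiF t f₁ x y z), enorm_mul _ (thw t 1 z * phiF t f₂ x y z)]
    have p1 := h₁.enorm_thw_mul_phiF_le ht x y hz0.le
    have p2 := h₂.enorm_thw_mul_phiF_le ht x y hz0.le
    have c1 : ‖z / angT t * (thw t 1 z)⁻¹‖ₑ * ENNReal.ofReal (√z) ≤ 9 := by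
      rw [Real.enorm_of_nonneg (by positivity), ← ENNReal.ofReal_mul (by positivity)]
      refine (ENNReal.ofReal_le_ofReal (q := 9) ?_).trans_eq (by norm_num)
      refine le_trans (le_of_eq ?_) (rpow_mul_inv_thw_le ht hz0.le)
      ring
    have c2 : ‖z ^ 2 / (2 * angT t ^ 2) * (thw t 1 z)⁻¹‖ₑ * ENNReal.ofReal (√z) *
        ENNReal.ofReal (√z) = ENNReal.ofReal (z ^ 3 / (2 * angT t ^ 2) * (thw t 1 z)⁻¹) := by
      rw [Real.enorm_of_nonneg (by positivity), ← ENNReal.ofReal_mul (by positivity),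
        ← ENNReal.ofReal_mul (by positivity), mul_assoc, Real.mul_self_sqrt hz0.le]
      congr 1
      ring
    refine add_le_add ?_ ?_
    · calc _ ≤ ‖z / angT t * (thw t 1 z)⁻¹‖ₑ * (ENNReal.ofReal (√z) * zNorm t f₂ x y) *
            ‖thw t 1 z * f₁ x y z‖ₑ * ‖thw t 1 z * f₃ x y z‖ₑ := by gcongr
        _ = (‖z / angT t * (thw t 1 z)⁻¹‖ₑ * ENNReal.ofReal (√z)) * zNorm t f₂ x y *
            (‖thw t 1 z * f₁ x y z‖ₑ * ‖thw t 1 z * f₃ x y z‖ₑ) := by ring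
        _ ≤ _ := by gcongr
    · calc _ ≤ ‖z ^ 2 / (2 * angT t ^ 2) * (thw t 1 z)⁻¹‖ₑ *
            (ENNReal.ofReal (√z) * zNorm t f₁ x y) * (ENNReal.ofReal (√z) * zNorm t f₂ x y) *
            ‖thw t 1 z * f₃ x y z‖ₑ := by gcongr
        _ = _ := by rw [← c2]; ring
  calc _ ≤ ∫⁻ z in Ioi (0 : ℝ), (9 * zNorm t f₂ x y *
        (‖thw t 1 z * f₁ x y z‖ₑ * ‖thw t 1 z * f₃ x y z‖ₑ) +
      zNorm t f₁ x y * zNorm t f₂ x y *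
        (ENNReal.ofReal (z ^ 3 / (2 * angT t ^ 2) * (thw t 1 z)⁻¹) *
          ‖thw t 1 z * f₃ x y z‖ₑ)) := setLIntegral_mono' measurableSet_Ioi hpt
    _ = 9 * zNorm t f₂ x y * (∫⁻ z in Ioi (0 : ℝ),
          ‖thw t 1 z * f₁ x y z‖ₑ * ‖thw t 1 z * f₃ x y z‖ₑ) +
        zNorm t f₁ x y * zNorm t f₂ x y * ∫⁻ z in Ioi (0 : ℝ),
          (ENNReal.ofReal (z ^ 3 / (2 * angT t ^ 2) * (thw t 1 z)⁻¹) *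
          ‖thw t 1 z * f₃ x y z‖ₑ) := by
        have m1 : Measurable fun z => ‖thw t 1 z * f₁ x y z‖ₑ * ‖thw t 1 z * f₃ x y z‖ₑ :=
          (hm h₁).mul (hm h₃)
        have m2 : Measurable fun z => ENNReal.ofReal (z ^ 3 / (2 * angT t ^ 2) *
          (thw t 1 z)⁻¹) * ‖thw t 1 z * f₃ x y z‖ₑ := hk.mul (hm h₃)
        rw [lintegral_add_left (m1.const_mul _), lintegral_const_mul _ m1,
          lintegral_const_mul _ m2]
    _ ≤ 9 * zNorm t f₂ x y * (zNorm t f₁ x y * zNorm t f₃ x y) +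
        zNorm t f₁ x y * zNorm t f₂ x y * (60 * zNorm t f₃ x y) := by
        gcongr
        · exact lintegral_mul_le_sqrt_mul_sqrt _ (hm h₁).aemeasurable (hm h₃).aemeasurable
        · refine (lintegral_mul_le_sqrt_mul_sqrt _ hk.aemeasurable (hm h₃).aemeasurable).trans ?_
          exact mul_le_mul_left (lintegral_sq_cube_mul_inv_thw_le ht) _
    _ = _ := by ring

/-- Cauchy–Schwarz in the horizontal variables -/
lemma SmoothXYZ.lintegral_weight_mul_zNorm_mul_le {f h : ℝ → ℝ → ℝ → ℝ} (hf : SmoothXYZ f)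
    (hh : SmoothXYZ h) (t : ℝ) (m n : ℕ) :
    ∫⁻ x : ℝ, ∫⁻ y : ℝ, ENNReal.ofReal (angR x y) ^ m * zNorm t f x y *
      (ENNReal.ofReal (angR x y) ^ n * zNorm t h x y) ≤
      normSq t m f ^ (1 / 2 : ℝ) * normSq t n h ^ (1 / 2 : ℝ) := by
  have hm : ∀ {f : ℝ → ℝ → ℝ → ℝ}, SmoothXYZ f → ∀ k : ℕ, Measurable fun p : ℝ × ℝ =>
      ENNReal.ofReal (angR p.1 p.2) ^ k * zNorm t f p.1 p.2 := fun hf k =>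
    (continuous_angR.measurable.ennreal_ofReal.pow_const k).mul
      (hf.measurable_zNorm t measurable_fst measurable_snd)
  have hn : ∀ {f : ℝ → ℝ → ℝ → ℝ}, SmoothXYZ f → ∀ k : ℕ,
      ∫⁻ p : ℝ × ℝ, (ENNReal.ofReal (angR p.1 p.2) ^ k * zNorm t f p.1 p.2) ^ 2 =
        normSq t k f := by
    intro f hf k
    rw [Measure.volume_eq_prod, lintegral_prod _ ((hm hf k).pow_const 2).aemeasurable]
    unfold normSq
    simp_rw [mul_pow, zNorm_sq, ← pow_mul, mul_comm k 2]
  have := lintegral_mul_le_sqrt_mul_sqrt (volume : Measure (ℝ × ℝ)) (hm hf m).aemeasurable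
    (hm hh n).aemeasurable
  rw [hn hf, hn hh] at this
  refine le_trans (le_of_eq ?_) this
  rw [Measure.volume_eq_prod]
  exact (lintegral_prod _ ((hm hf m).mul (hm hh n)).aemeasurable).symm

/-- `‖θ ⟨r⟩^{|α|} ∂^α_h g‖_{L²}` for `α = (a, b)` -/
def derivNorm (t : ℝ) (g : ℝ → ℝ → ℝ → ℝ) (a b : ℕ) : ℝ := L2w t 1 (a + b) (pdh a b g)

/-- a bound of `θ ⟨r⟩^{|α|} ∂^α_h g` in `L^∞_h L²_z` for `α = (a, b)` -/
def supBound (t : ℝ) (g : ℝ → ℝ → ℝ → ℝ) (a b : ℕ) : ℝ :=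
  2 * (derivNorm t g a b + derivNorm t g (a + 1) b + derivNorm t g a (b + 1) +
    derivNorm t g (a + 1) (b + 1))

/-- a bound of the product of two derivatives in `L²`, the lower one being put in `L^∞_h` -/
def pairBound (t : ℝ) (g : ℝ → ℝ → ℝ → ℝ) (i j k l : ℕ) : ℝ :=
  if i + j ≤ k + l then supBound t g i j * derivNorm t g k l
  else derivNorm t g i j * supBound t g k l

lemma derivNorm_nonneg (t : ℝ) (g : ℝ → ℝ → ℝ → ℝ) (a b : ℕ) : 0 ≤ derivNorm t g a b :=
  Real.sqrt_nonneg _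

lemma supBound_nonneg (t : ℝ) (g : ℝ → ℝ → ℝ → ℝ) (a b : ℕ) : 0 ≤ supBound t g a b := by
  have h := derivNorm_nonneg t g
  have := h a b; have := h (a + 1) b; have := h a (b + 1); have := h (a + 1) (b + 1)
  unfold supBound; positivity

lemma pairBound_nonneg (t : ℝ) (g : ℝ → ℝ → ℝ → ℝ) (i j k l : ℕ) : 0 ≤ pairBound t g i j k l := by
  have h := derivNorm_nonneg t g
  have h' := supBound_nonneg t g
  unfold pairBound
  split_ifs
  exacts [mul_nonneg (h' _ _) (h _ _), mul_nonneg (h _ _) (h' _ _)]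

lemma normSq_eq_derivNorm_sq {t : ℝ} {g : ℝ → ℝ → ℝ → ℝ} (hI : L2cond t g) (a b : ℕ) :
    normSq t (a + b) (pdh a b g) = ENNReal.ofReal (derivNorm t g a b) ^ 2 :=
  (ofReal_L2w_sq (hI a b)).symm

lemma normSq_mono_weight (t : ℝ) {m n : ℕ} (h : m ≤ n) (f : ℝ → ℝ → ℝ → ℝ) :
    normSq t m f ≤ normSq t n f := by
  unfold normSq
  refine lintegral_mono fun x => lintegral_mono fun y => ?_
  have : 1 ≤ ENNReal.ofReal (angR x y) := ENNReal.one_le_ofReal.2 (one_le_angR x y)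
  gcongr

lemma SmoothXYZ.weight_mul_zNorm_pdh_le {g : ℝ → ℝ → ℝ → ℝ} (hg : SmoothXYZ g) {t : ℝ}
    (hI : L2cond t g) (a b : ℕ) (x y : ℝ) :
    ENNReal.ofReal (angR x y) ^ (a + b) * zNorm t (_root_.pdh a b g) x y ≤
      ENNReal.ofReal (supBound t g a b) := by
  have hN := derivNorm_nonneg t g
  rw [← ENNReal.pow_le_pow_left_iff two_ne_zero, mul_pow, zNorm_sq, ← pow_mul, mul_comm (a + b) 2]
  have h := (hg.pdh a b).weight_mul_zNormSq_le t (a + b) x y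
  rw [_root_.pdx_pdh, hg.pdy_pdh, hg.pdy_pdh, normSq_eq_derivNorm_sq hI] at h
  have h1 : normSq t (a + b) (_root_.pdh (a + 1) b g) ≤
      ENNReal.ofReal (derivNorm t g (a + 1) b) ^ 2 :=
    (normSq_mono_weight t (by omega) _).trans_eq (normSq_eq_derivNorm_sq hI _ _)
  have h2 : normSq t (a + b) (_root_.pdh a (b + 1) g) ≤
      ENNReal.ofReal (derivNorm t g a (b + 1)) ^ 2 :=
    (normSq_mono_weight t (by omega) _).trans_eq (normSq_eq_derivNorm_sq hI _ _)
  have h3 : normSq t (a + b) (_root_.pdh (a + 1) (b + 1) g) ≤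
      ENNReal.ofReal (derivNorm t g (a + 1) (b + 1)) ^ 2 :=
    (normSq_mono_weight t (by omega) _).trans_eq (normSq_eq_derivNorm_sq hI _ _)
  unfold supBound
  rw [ENNReal.ofReal_mul zero_le_two, ENNReal.ofReal_add _ (hN _ _),
    ENNReal.ofReal_add _ (hN _ _), ENNReal.ofReal_add (hN _ _) (hN _ _), ENNReal.ofReal_ofNat]
  rotate_left
  · exact add_nonneg (hN _ _) (hN _ _)
  · exact add_nonneg (add_nonneg (hN _ _) (hN _ _)) (hN _ _)
  refine (h.trans (add_le_add (add_le_add (add_le_add le_rfl (mul_le_mul_right h1 2))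
    (mul_le_mul_right h2 2)) h3)).trans ?_
  generalize ENNReal.ofReal (derivNorm t g a b) = A
  generalize ENNReal.ofReal (derivNorm t g (a + 1) b) = B
  generalize ENNReal.ofReal (derivNorm t g a (b + 1)) = C
  generalize ENNReal.ofReal (derivNorm t g (a + 1) (b + 1)) = D
  calc _ ≤ 4 * A ^ 2 + 2 * B ^ 2 + 2 * C ^ 2 + D ^ 2 + (2 * B ^ 2 + 2 * C ^ 2 + 3 * D ^ 2 +
        8 * (A * B + A * C + A * D + B * C + B * D + C * D)) := le_self_add
    _ = _ := by ring

/-- the trilinear estimate in the horizontal variables -/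
lemma SmoothXYZ.lintegral_horizontal_le {g : ℝ → ℝ → ℝ → ℝ} (hg : SmoothXYZ g) {t : ℝ}
    (hI : L2cond t g) {a b i j k l : ℕ} (h : a + b = i + j + (k + l)) :
    ∫⁻ x : ℝ, ∫⁻ y : ℝ, ENNReal.ofReal (angR x y) ^ (2 * (a + b)) *
      (zNorm t (_root_.pdh i j g) x y * zNorm t (_root_.pdh k l g) x y *
        zNorm t (_root_.pdh a b g) x y) ≤
      ENNReal.ofReal (pairBound t g i j k l * derivNorm t g a b) := by
  have hN := derivNorm_nonneg t g
  have key : ∀ i j k l : ℕ, a + b = i + j + (k + l) →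
      ∫⁻ x : ℝ, ∫⁻ y : ℝ, ENNReal.ofReal (angR x y) ^ (2 * (a + b)) *
      (zNorm t (_root_.pdh i j g) x y * zNorm t (_root_.pdh k l g) x y *
        zNorm t (_root_.pdh a b g) x y) ≤
      ENNReal.ofReal (supBound t g i j * derivNorm t g k l * derivNorm t g a b) := by
    intro i j k l h
    calc _ ≤ ∫⁻ x : ℝ, ∫⁻ y : ℝ, ENNReal.ofReal (supBound t g i j) *
          (ENNReal.ofReal (angR x y) ^ (k + l) * zNorm t (_root_.pdh k l g) x y *
          (ENNReal.ofReal (angR x y) ^ (a + b) * zNorm t (_root_.pdh a b g) x y)) := by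
          refine lintegral_mono fun x => lintegral_mono fun y => ?_
          refine le_trans (le_of_eq ?_) (mul_le_mul_left
            (hg.weight_mul_zNorm_pdh_le hI i j x y) _)
          rw [two_mul, pow_add]
          nth_rw 1 [h]
          ring
      _ = ENNReal.ofReal (supBound t g i j) * ∫⁻ x : ℝ, ∫⁻ y : ℝ,
          (ENNReal.ofReal (angR x y) ^ (k + l) * zNorm t (_root_.pdh k l g) x y *
          (ENNReal.ofReal (angR x y) ^ (a + b) * zNorm t (_root_.pdh a b g) x y)) := by
          simp_rw [lintegral_const_mul' _ _ ENNReal.ofReal_ne_top]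
      _ ≤ ENNReal.ofReal (supBound t g i j) * (normSq t (k + l) (_root_.pdh k l g) ^ (1 / 2 : ℝ) *
          normSq t (a + b) (_root_.pdh a b g) ^ (1 / 2 : ℝ)) := by
          gcongr
          exact (hg.pdh k l).lintegral_weight_mul_zNorm_mul_le (hg.pdh a b) t _ _
      _ = _ := by
          rw [normSq_eq_derivNorm_sq hI, normSq_eq_derivNorm_sq hI, ENNReal.sq_rpow_half,
            ENNReal.sq_rpow_half,
            ENNReal.ofReal_mul (mul_nonneg (supBound_nonneg t g i j) (hN _ _)),
            ENNReal.ofReal_mul (supBound_nonneg t g i j), mul_assoc]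
  unfold pairBound
  split_ifs
  · exact key i j k l h
  · rw [mul_comm (derivNorm t g i j)]
    refine le_trans (le_of_eq ?_) (key k l i j (by omega))
    simp_rw [mul_comm (zNorm t (_root_.pdh i j g) _ _)]

lemma lintegral_lintegral_finsetSum {ι : Type*} (s : Finset ι) {F : ι → ℝ → ℝ → ℝ≥0∞}
    (hF : ∀ i, Measurable fun p : ℝ × ℝ => F i p.1 p.2) :
    ∫⁻ x, ∫⁻ y, ∑ i ∈ s, F i x y = ∑ i ∈ s, ∫⁻ x, ∫⁻ y, F i x y := by
  refine (lintegral_congr fun x => lintegral_finsetSum s (f := fun i y => F i x y)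
    fun i _ => (hF i).comp measurable_prodMk_left).trans ?_
  exact lintegral_finsetSum s fun i _ => (hF i).lintegral_prod_right'

lemma enorm_trip_le (F : ℝ → ℝ → ℝ → ℝ) :
    ‖trip F‖ₑ ≤ ∫⁻ x, ∫⁻ y, ∫⁻ z in Ioi (0 : ℝ), ‖F x y z‖ₑ :=
  (enorm_integral_le_lintegral_enorm _).trans <| lintegral_mono fun _ =>
    (enorm_integral_le_lintegral_enorm _).trans <| lintegral_mono fun _ =>
      enorm_integral_le_lintegral_enorm _

/-- the single integral `I^α_5` -/
lemma abs_I5_le {t : ℝ} (ht : 0 ≤ t) {g : ℝ → ℝ → ℝ → ℝ} (hg : SmoothXYZ g)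
    (hI : L2cond t g) (a b : ℕ) :
    |I5 t g a b| ≤ 69 * (∑ j ∈ Finset.range (b + 1), ∑ i ∈ Finset.range (a + 1),
      (a.choose i * b.choose j : ℝ) * pairBound t g i j (a - i) (b - j)) * derivNorm t g a b := by
  have hT := angT_pos ht
  let s : Finset (ℕ × ℕ) := Finset.range (b + 1) ×ˢ Finset.range (a + 1)
  let c : ℕ × ℕ → ℝ := fun p => a.choose p.2 * b.choose p.1
  have hc : ∀ p, 0 ≤ c p := fun p => by positivity
  have hP := pairBound_nonneg t g
  have hN := derivNorm_nonneg t g a b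
  rw [← Finset.sum_product' (f := fun j i => (a.choose i * b.choose j : ℝ) *
    pairBound t g i j (a - i) (b - j))]
  let V : ℕ × ℕ → ℝ → ℝ → ℝ → ℝ := fun p x y z => 1 / angT t * (z * thw t 2 z *
    (urOp t (pdh p.2 p.1 g) x y z * phiF t (pdh (a - p.2) (b - p.1) g) x y z) * pdh a b g x y z)
  have hV : ∀ p x y, Measurable fun z => ‖V p x y z‖ₑ := by
    intro p x y
    have h1 := (hg.pdh p.2 p.1).continuous_urOp t x y
    have h2 := (hg.pdh (a - p.2) (b - p.1)).continuous_phiF t x y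
    have h3 := (hg.pdh a b).continuous_z x y
    exact (continuous_const.mul (((continuous_id.mul (continuous_thw t 2)).mul
      (h1.mul h2)).mul h3)).measurable.enorm
  have hint : ∀ x y z, 1 / angT t * (z * thw t 2 z * angR x y ^ (2 * (a + b)) *
      pdh a b (fun x' y' z' => ur t g x' y' z' * phiF t g x' y' z') x y z * pdh a b g x y z) =
      ∑ p ∈ s, c p * angR x y ^ (2 * (a + b)) * V p x y z := by
    intro x y z
    rw [ur_eq_urOp ht hg, pdh_mul (commutesHoriz_urOp t) (commutesHoriz_phiF t) hg,
      ← Finset.sum_product' (f := fun j i => (a.choose i * b.choose j : ℝ) *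
        (urOp t (pdh i j g) x y z * phiF t (pdh (a - i) (b - j) g) x y z)),
      Finset.mul_sum, Finset.sum_mul, Finset.mul_sum]
    refine Finset.sum_congr rfl fun p _ => ?_
    simp only [c, V]
    ring
  have hz : ∀ x y, ∫⁻ z in Ioi (0 : ℝ), ‖1 / angT t * (z * thw t 2 z * angR x y ^ (2 * (a + b)) *
      pdh a b (fun x' y' z' => ur t g x' y' z' * phiF t g x' y' z') x y z * pdh a b g x y z)‖ₑ ≤
      ∑ p ∈ s, ENNReal.ofReal (69 * c p) * (ENNReal.ofReal (angR x y) ^ (2 * (a + b)) *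
        (zNorm t (pdh p.2 p.1 g) x y * zNorm t (pdh (a - p.2) (b - p.1) g) x y *
          zNorm t (pdh a b g) x y)) := by
    intro x y
    have hr : 0 ≤ angR x y := zero_le_one.trans (one_le_angR x y)
    calc _ ≤ ∫⁻ z in Ioi (0 : ℝ), ∑ p ∈ s,
          ‖c p * angR x y ^ (2 * (a + b))‖ₑ * ‖V p x y z‖ₑ := by
          refine lintegral_mono fun z => ?_
          simp only [hint]
          refine (enorm_sum_le _ _).trans_eq (Finset.sum_congr rfl fun p _ => enorm_mul _ _)
      _ = ∑ p ∈ s, ‖c p * angR x y ^ (2 * (a + b))‖ₑ * ∫⁻ z in Ioi (0 : ℝ), ‖V p x y z‖ₑ := by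
          rw [lintegral_finsetSum s fun p _ => (hV p x y).const_mul _]
          exact Finset.sum_congr rfl fun p _ => lintegral_const_mul _ (hV p x y)
      _ ≤ ∑ p ∈ s, ‖c p * angR x y ^ (2 * (a + b))‖ₑ * (69 * (zNorm t (pdh p.2 p.1 g) x y *
          zNorm t (pdh (a - p.2) (b - p.1) g) x y * zNorm t (pdh a b g) x y)) := by
          gcongr with p
          exact lintegral_vertical_le (hg.pdh _ _) (hg.pdh _ _) (hg.pdh _ _) ht x y
      _ = _ := by
          refine Finset.sum_congr rfl fun p _ => ?_
          rw [Real.enorm_of_nonneg (mul_nonneg (hc p) (by positivity)), ENNReal.ofReal_mul (hc p),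
            ENNReal.ofReal_mul (by norm_num : (0 : ℝ) ≤ 69), ENNReal.ofReal_pow hr,
            ENNReal.ofReal_ofNat]
          ring
  have hmeas : ∀ p : ℕ × ℕ, Measurable fun q : ℝ × ℝ => ENNReal.ofReal (69 * c p) *
      (ENNReal.ofReal (angR q.1 q.2) ^ (2 * (a + b)) * (zNorm t (pdh p.2 p.1 g) q.1 q.2 *
        zNorm t (pdh (a - p.2) (b - p.1) g) q.1 q.2 * zNorm t (pdh a b g) q.1 q.2)) := by
    intro p
    have h : ∀ i j, Measurable fun q : ℝ × ℝ => zNorm t (pdh i j g) q.1 q.2 := fun i j =>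
      (hg.pdh i j).measurable_zNorm t measurable_fst measurable_snd
    exact ((continuous_angR.measurable.ennreal_ofReal.pow_const _).mul
      (((h _ _).mul (h _ _)).mul (h _ _))).const_mul _
  have main : ‖I5 t g a b‖ₑ ≤ ENNReal.ofReal (69 * (∑ p ∈ s, c p *
      pairBound t g p.2 p.1 (a - p.2) (b - p.1)) * derivNorm t g a b) := by
    calc ‖I5 t g a b‖ₑ ≤ ‖1 / angT t‖ₑ * ∫⁻ x, ∫⁻ y, ∫⁻ z in Ioi (0 : ℝ),
          ‖z * thw t 2 z * angR x y ^ (2 * (a + b)) * pdh a b (fun x' y' z' =>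
            ur t g x' y' z' * phiF t g x' y' z') x y z * pdh a b g x y z‖ₑ := by
          unfold I5
          rw [enorm_mul, enorm_neg]
          gcongr
          exact enorm_trip_le _
      _ = ∫⁻ x, ∫⁻ y, ∫⁻ z in Ioi (0 : ℝ), ‖1 / angT t * (z * thw t 2 z *
          angR x y ^ (2 * (a + b)) * pdh a b (fun x' y' z' =>
            ur t g x' y' z' * phiF t g x' y' z') x y z * pdh a b g x y z)‖ₑ := by
          simp_rw [enorm_mul (1 / angT t), lintegral_const_mul' _ _ enorm_ne_top]
      _ ≤ _ := lintegral_mono fun x => lintegral_mono fun y => hz x y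
      _ = _ := lintegral_lintegral_finsetSum s hmeas
      _ ≤ ∑ p ∈ s, ENNReal.ofReal (69 * c p) * ENNReal.ofReal
          (pairBound t g p.2 p.1 (a - p.2) (b - p.1) * derivNorm t g a b) := by
          refine Finset.sum_le_sum fun p hp => ?_
          simp_rw [lintegral_const_mul' _ _ ENNReal.ofReal_ne_top]
          gcongr
          simp only [s, Finset.mem_product, Finset.mem_range] at hp
          exact hg.lintegral_horizontal_le hI (by omega)
      _ = _ := by
          rw [Finset.mul_sum, Finset.sum_mul, ENNReal.ofReal_sum_of_nonneg]
          · refine Finset.sum_congr rfl fun p _ => ?_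
            rw [← ENNReal.ofReal_mul (mul_nonneg (by norm_num) (hc p))]
            congr 1
            ring
          · exact fun p _ =>
              mul_nonneg (mul_nonneg (by norm_num) (mul_nonneg (hc p) (hP _ _ _ _))) hN
  rw [Real.enorm_eq_ofReal_abs] at main
  refine (ENNReal.ofReal_le_ofReal_iff ?_).1 main
  exact mul_nonneg (mul_nonneg (by norm_num) (Finset.sum_nonneg fun p _ =>
    mul_nonneg (hc p) (hP _ _ _ _))) hN

lemma Mfac_pos (n : ℕ) : 0 < Mfac n := by unfold Mfac; positivity

lemma choose_mul_choose_le {a b i j : ℕ} : a.choose i * b.choose j ≤ (a + b).choose (i + j) := by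
  rw [Nat.add_choose_eq]
  exact Finset.single_le_sum (f := fun ij : ℕ × ℕ => a.choose ij.1 * b.choose ij.2)
    (fun _ _ => Nat.zero_le _)
    (Finset.HasAntidiagonal.mem_antidiagonal.2 (rfl : (i, j).1 + (i, j).2 = i + j))

lemma Mfac_mul_choose_le {m n : ℕ} (h : m ≤ n) :
    Mfac (m + n) * (m + n).choose m ≤ 16 * (1 / m.factorial * Mfac n) := by
  have hmn : ((m + n).choose m : ℝ) * m.factorial * n.factorial = (m + n).factorial := by
    rw [Nat.choose_symm_add]
    exact_mod_cast Nat.add_choose_mul_factorial_mul_factorial m n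
  have hm : (0 : ℝ) < m.factorial := by positivity
  have hn : (0 : ℝ) < n.factorial := by positivity
  have h' : (m : ℝ) ≤ n := by exact_mod_cast h
  have hp : ((m : ℝ) + n + 1) ^ 4 ≤ (2 * (n + 1)) ^ 4 := by gcongr; linarith
  have hc : ((m + n).choose m : ℝ) ≠ 0 := by
    exact_mod_cast (Nat.choose_pos (Nat.le_add_right m n)).ne'
  unfold Mfac
  rw [← hmn]
  push_cast
  calc _ = ((m : ℝ) + n + 1) ^ 4 / (m.factorial * n.factorial) := by field_simp
    _ ≤ (2 * ((n : ℝ) + 1)) ^ 4 / (m.factorial * n.factorial) := by gcongr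
    _ = _ := by field_simp; ring

lemma pow_div_factorial_le {τ τ₀ : ℝ} (hτ : 0 < τ) (hle : τ ≤ τ₀) (k : ℕ) {d : ℕ} (hd : d ≤ 2) :
    τ ^ k / k.factorial ≤ (1 + τ₀) ^ 2 / τ ^ 2 * (τ ^ (k + d) * Mfac (k + d)) := by
  have hk : (0 : ℝ) < k.factorial := by positivity
  have h1 : 1 / (k.factorial : ℝ) ≤ Mfac (k + d) := by
    have hk0 : (0 : ℝ) ≤ k := k.cast_nonneg
    unfold Mfac
    rw [div_le_div_iff₀ hk (by positivity)]
    interval_cases d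
    · simp only [add_zero]
      nlinarith [one_le_pow₀ (n := 4) (by linarith : (1 : ℝ) ≤ k + 1)]
    · rw [Nat.factorial_succ]
      push_cast
      have : (k : ℝ) + 1 ≤ (k + 1 + 1) ^ 4 :=
        (by linarith : (k : ℝ) + 1 ≤ k + 1 + 1).trans (le_self_pow₀ (by linarith) (by norm_num))
      nlinarith
    · rw [Nat.factorial_succ, Nat.factorial_succ]
      push_cast
      have : ((k : ℝ) + 1 + 1) * (k + 1) ≤ (k + 2 + 1) ^ 4 :=
        (by nlinarith : ((k : ℝ) + 1 + 1) * (k + 1) ≤ (k + 2 + 1) ^ 2).trans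
          (pow_le_pow_right₀ (by linarith) (by norm_num))
      nlinarith
  have h2 : τ ^ 2 ≤ (1 + τ₀) ^ 2 * τ ^ d := by
    have h0 : 0 < τ₀ := hτ.trans_le hle
    have hd1 : 1 ≤ (1 + τ₀) ^ 2 := by nlinarith
    have hd2 : τ ≤ (1 + τ₀) ^ 2 := by nlinarith
    interval_cases d
    · nlinarith
    · nlinarith [mul_le_mul_of_nonneg_right hd2 hτ.le]
    · nlinarith [mul_le_mul_of_nonneg_right hd1 (sq_nonneg τ)]
  rw [div_mul_eq_mul_div, le_div_iff₀ (by positivity), pow_add]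
  calc _ = τ ^ k * (τ ^ 2 * (1 / k.factorial)) := by ring
    _ ≤ τ ^ k * ((1 + τ₀) ^ 2 * τ ^ d * Mfac (k + d)) := by gcongr
    _ = _ := by ring

lemma sum_triangle_le_sum_square {f : ℕ → ℕ → ℝ} (hf : ∀ a b, 0 ≤ f a b) (N : ℕ) :
    ∑ n ∈ Finset.range N, ∑ a ∈ Finset.range (n + 1), f a (n - a) ≤
      ∑ a ∈ Finset.range N, ∑ b ∈ Finset.range N, f a b := by
  rw [Finset.sum_range_diag_flip]
  gcongr with a
  · exact fun _ _ _ => hf _ _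
  · exact Nat.sub_le N a

lemma sum_rectangle_le_sum_triangle {f : ℕ → ℕ → ℝ} (hf : ∀ a b, 0 ≤ f a b) (M N : ℕ) :
    ∑ a ∈ Finset.range M, ∑ b ∈ Finset.range N, f a b ≤
      ∑ n ∈ Finset.range (M + N), ∑ a ∈ Finset.range (n + 1), f a (n - a) := by
  rw [Finset.sum_range_diag_flip]
  calc _ ≤ ∑ a ∈ Finset.range M, ∑ b ∈ Finset.range (M + N - a), f a b := by
        refine Finset.sum_le_sum fun a ha => ?_
        have := Finset.mem_range.1 ha
        exact Finset.sum_le_sum_of_subset_of_nonneg (Finset.range_subset_range.2 (by omega))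
          fun _ _ _ => hf _ _
    _ ≤ _ := Finset.sum_le_sum_of_subset_of_nonneg (Finset.range_subset_range.2 (by omega))
        fun _ _ _ => Finset.sum_nonneg fun _ _ => hf _ _

lemma sum_convolution_le {G : ℕ → ℕ → ℕ → ℕ → ℝ} (hG : ∀ i j k l, 0 ≤ G i j k l) (N : ℕ) :
    ∑ a ∈ Finset.range N, ∑ b ∈ Finset.range N, ∑ j ∈ Finset.range (b + 1),
      ∑ i ∈ Finset.range (a + 1), G i j (a - i) (b - j) ≤
    ∑ i ∈ Finset.range N, ∑ k ∈ Finset.range N, ∑ j ∈ Finset.range N, ∑ l ∈ Finset.range N,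
      G i j k l := by
  calc _ = ∑ a ∈ Finset.range N, ∑ i ∈ Finset.range (a + 1), ∑ b ∈ Finset.range N,
        ∑ j ∈ Finset.range (b + 1), G i j (a - i) (b - j) := by
        refine Finset.sum_congr rfl fun a _ => ?_
        rw [Finset.sum_comm]
        exact Finset.sum_congr rfl fun b _ => Finset.sum_comm
    _ ≤ ∑ a ∈ Finset.range N, ∑ i ∈ Finset.range (a + 1), ∑ j ∈ Finset.range N,
        ∑ l ∈ Finset.range N, G i j (a - i) l := by
        refine Finset.sum_le_sum fun a _ => Finset.sum_le_sum fun i _ => ?_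
        exact sum_triangle_le_sum_square (fun j l => hG i j (a - i) l) N
    _ ≤ _ := sum_triangle_le_sum_square (fun i k => Finset.sum_nonneg fun j _ =>
        Finset.sum_nonneg fun l _ => hG i j k l) N

lemma Xel_eq (t τ : ℝ) (g : ℝ → ℝ → ℝ → ℝ) (n : ℕ) :
    Xel t τ g n = ∑ a ∈ Finset.range (n + 1),
      τ ^ (a + (n - a)) * Mfac (a + (n - a)) * derivNorm t g a (n - a) := by
  unfold Xel derivNorm
  rw [Finset.sum_mul, Finset.sum_mul]
  refine Finset.sum_congr rfl fun a ha => ?_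
  rw [Nat.add_sub_of_le (Nat.lt_succ_iff.1 (Finset.mem_range.1 ha))]
  ring

lemma sum_shifted_derivNorm_le {t τ : ℝ} {g : ℝ → ℝ → ℝ → ℝ} (hτ : 0 < τ)
    (hs : Summable (Xel t τ g)) (N d e : ℕ) :
    ∑ i ∈ Finset.range N, ∑ j ∈ Finset.range N,
      τ ^ (i + d + (j + e)) * Mfac (i + d + (j + e)) * derivNorm t g (i + d) (j + e) ≤
      Xnrm t τ g := by
  set q : ℕ → ℕ → ℝ := fun i j => τ ^ (i + j) * Mfac (i + j) * derivNorm t g i j with hq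
  have hq0 : ∀ i j, 0 ≤ q i j := fun i j =>
    mul_nonneg (mul_nonneg (by positivity) (Mfac_pos _).le) (derivNorm_nonneg t g i j)
  have hX : ∀ n, Xel t τ g n = ∑ a ∈ Finset.range (n + 1), q a (n - a) := Xel_eq t τ g
  have hshift : ∀ (f : ℕ → ℝ) (d : ℕ), (∀ i, 0 ≤ f i) →
      ∑ i ∈ Finset.range N, f (i + d) ≤ ∑ i ∈ Finset.range (d + N), f i := by
    intro f d hf
    rw [Finset.sum_range_add]
    simp_rw [add_comm _ d]
    exact le_add_of_nonneg_left (Finset.sum_nonneg fun i _ => hf i)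
  calc ∑ i ∈ Finset.range N, ∑ j ∈ Finset.range N, q (i + d) (j + e)
      ≤ ∑ i ∈ Finset.range N, ∑ j ∈ Finset.range (e + N), q (i + d) j :=
        Finset.sum_le_sum fun i _ => hshift (q (i + d)) e (hq0 _)
    _ ≤ ∑ i ∈ Finset.range (d + N), ∑ j ∈ Finset.range (e + N), q i j :=
        hshift (fun i => ∑ j ∈ Finset.range (e + N), q i j) d
          fun i => Finset.sum_nonneg fun j _ => hq0 i j
    _ ≤ ∑ n ∈ Finset.range (d + N + (e + N)), Xel t τ g n := by
        simp_rw [hX]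
        exact sum_rectangle_le_sum_triangle hq0 _ _
    _ ≤ _ := hs.sum_le_tsum _ fun n _ => by
        rw [hX]; exact Finset.sum_nonneg fun a _ => hq0 _ _

lemma sum_supBound_le {t τ τ₀ : ℝ} {g : ℝ → ℝ → ℝ → ℝ} (hτ : 0 < τ) (hle : τ ≤ τ₀)
    (hs : Summable (Xel t τ g)) (N : ℕ) :
    ∑ i ∈ Finset.range N, ∑ j ∈ Finset.range N,
      τ ^ (i + j) / (i + j).factorial * supBound t g i j ≤
      8 * ((1 + τ₀) ^ 2 / τ ^ 2) * Xnrm t τ g := by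
  set c := (1 + τ₀) ^ 2 / τ ^ 2 with hc
  have hc0 : 0 ≤ c := by positivity
  have key : ∀ d e : ℕ, d + e ≤ 2 → ∑ i ∈ Finset.range N, ∑ j ∈ Finset.range N,
      τ ^ (i + j) / (i + j).factorial * derivNorm t g (i + d) (j + e) ≤ c * Xnrm t τ g := by
    intro d e hde
    refine le_trans ?_ (mul_le_mul_of_nonneg_left (sum_shifted_derivNorm_le hτ hs N d e) hc0)
    simp_rw [Finset.mul_sum]
    refine Finset.sum_le_sum fun i _ => Finset.sum_le_sum fun j _ => ?_
    rw [← mul_assoc]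
    refine mul_le_mul_of_nonneg_right ?_ (derivNorm_nonneg _ _ _ _)
    rw [show i + d + (j + e) = i + j + (d + e) by ring]
    exact pow_div_factorial_le hτ hle _ hde
  have h := add_le_add (add_le_add (add_le_add (key 0 0 (by norm_num)) (key 1 0 (by norm_num)))
    (key 0 1 (by norm_num))) (key 1 1 (by norm_num))
  simp_rw [← Finset.sum_add_distrib] at h
  calc _ = 2 * ∑ i ∈ Finset.range N, ∑ j ∈ Finset.range N,
        (τ ^ (i + j) / (i + j).factorial * derivNorm t g (i + 0) (j + 0) +
        τ ^ (i + j) / (i + j).factorial * derivNorm t g (i + 1) (j + 0) +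
        τ ^ (i + j) / (i + j).factorial * derivNorm t g (i + 0) (j + 1) +
        τ ^ (i + j) / (i + j).factorial * derivNorm t g (i + 1) (j + 1)) := by
        simp_rw [Finset.mul_sum]
        refine Finset.sum_congr rfl fun i _ => Finset.sum_congr rfl fun j _ => ?_
        simp only [supBound, add_zero]
        ring
    _ ≤ _ := by linarith

lemma weight_mul_pairBound_le {t τ : ℝ} (g : ℝ → ℝ → ℝ → ℝ) (hτ : 0 < τ) {a b i j : ℕ}
    (hi : i ≤ a) (hj : j ≤ b) :
    τ ^ (a + b) * Mfac (a + b) *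
      ((a.choose i * b.choose j : ℝ) * pairBound t g i j (a - i) (b - j)) ≤
    16 * (τ ^ (i + j) / (i + j).factorial * supBound t g i j *
        (τ ^ (a - i + (b - j)) * Mfac (a - i + (b - j)) * derivNorm t g (a - i) (b - j)) +
      τ ^ (i + j) * Mfac (i + j) * derivNorm t g i j *
        (τ ^ (a - i + (b - j)) / (a - i + (b - j)).factorial *
          supBound t g (a - i) (b - j))) := by
  obtain ⟨k, rfl⟩ := Nat.exists_eq_add_of_le hi
  obtain ⟨l, rfl⟩ := Nat.exists_eq_add_of_le hj
  simp only [Nat.add_sub_cancel_left]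
  have hch : (((i + k).choose i : ℝ) * (j + l).choose j) ≤ (i + j + (k + l)).choose (i + j) := by
    rw [show i + j + (k + l) = i + k + (j + l) by ring]
    exact_mod_cast choose_mul_choose_le
  rw [show i + k + (j + l) = i + j + (k + l) by ring]
  have hS := supBound_nonneg t g
  have hN := derivNorm_nonneg t g
  have hM := fun n => (Mfac_pos n).le
  set m := i + j
  set n := k + l
  have hA : 0 ≤ τ ^ m / m.factorial * supBound t g i j * (τ ^ n * Mfac n * derivNorm t g k l) :=
    mul_nonneg (mul_nonneg (by positivity) (hS _ _))
      (mul_nonneg (mul_nonneg (by positivity) (hM _)) (hN _ _))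
  have hB : 0 ≤ τ ^ m * Mfac m * derivNorm t g i j * (τ ^ n / n.factorial * supBound t g k l) :=
    mul_nonneg (mul_nonneg (mul_nonneg (by positivity) (hM _)) (hN _ _))
      (mul_nonneg (by positivity) (hS _ _))
  have hP := pairBound_nonneg t g i j k l
  have h1 : τ ^ (m + n) * Mfac (m + n) * (((i + k).choose i * (j + l).choose j : ℝ) *
      pairBound t g i j k l) ≤ τ ^ (m + n) * (Mfac (m + n) * (m + n).choose m) *
        pairBound t g i j k l := by
    have := hM (m + n)
    calc _ = τ ^ (m + n) * (Mfac (m + n) * ((i + k).choose i * (j + l).choose j)) *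
          pairBound t g i j k l := by ring
      _ ≤ _ := by gcongr
  refine h1.trans ?_
  unfold pairBound at hP ⊢
  split_ifs at hP ⊢ with h
  · calc _ ≤ τ ^ (m + n) * (16 * (1 / m.factorial * Mfac n)) *
          (supBound t g i j * derivNorm t g k l) := by
          have := Mfac_mul_choose_le h
          gcongr
      _ = 16 * (τ ^ m / m.factorial * supBound t g i j *
          (τ ^ n * Mfac n * derivNorm t g k l)) := by rw [pow_add]; ring
      _ ≤ _ := by linarith
  · have h2 : Mfac (m + n) * (m + n).choose m ≤ 16 * (1 / n.factorial * Mfac m) := by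
      rw [Nat.choose_symm_add, add_comm m n]
      exact Mfac_mul_choose_le (not_le.1 h).le
    calc _ ≤ τ ^ (m + n) * (16 * (1 / n.factorial * Mfac m)) *
          (derivNorm t g i j * supBound t g k l) := by gcongr
      _ = 16 * (τ ^ m * Mfac m * derivNorm t g i j *
          (τ ^ n / n.factorial * supBound t g k l)) := by rw [pow_add]; ring
      _ ≤ _ := by linarith

lemma Xnrm_nonneg {t τ : ℝ} (hτ : 0 < τ) (g : ℝ → ℝ → ℝ → ℝ) : 0 ≤ Xnrm t τ g :=
  tsum_nonneg fun n => mul_nonneg (mul_nonneg (Finset.sum_nonneg fun _ _ => Real.sqrt_nonneg _)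
    (by positivity)) (Mfac_pos n).le

lemma sum_Qterm_I5_le {t τ τ₀ : ℝ} (ht : 0 ≤ t) {g : ℝ → ℝ → ℝ → ℝ} (hg : SmoothXYZ g)
    (hI : L2cond t g) (hτ : 0 < τ) (hle : τ ≤ τ₀) (hs : Summable (Xel t τ g)) (N : ℕ) :
    ∑ n ∈ Finset.range N, Qterm t τ g (I5 t g) n ≤
      17664 * (1 + τ₀) ^ 2 / τ ^ 2 * Xnrm t τ g * Xnrm t τ g := by
  let p : ℕ → ℕ → ℝ := fun i j => τ ^ (i + j) / (i + j).factorial * supBound t g i j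
  let q : ℕ → ℕ → ℝ := fun i j => τ ^ (i + j) * Mfac (i + j) * derivNorm t g i j
  have hp : ∀ i j, 0 ≤ p i j := fun i j => mul_nonneg (by positivity) (supBound_nonneg t g i j)
  have hq : ∀ i j, 0 ≤ q i j := fun i j =>
    mul_nonneg (mul_nonneg (by positivity) (Mfac_pos _).le) (derivNorm_nonneg t g i j)
  let G : ℕ → ℕ → ℕ → ℕ → ℝ := fun i j k l => 69 * (16 * (p i j * q k l + q i j * p k l))
  have hG : ∀ i j k l, 0 ≤ G i j k l := fun i j k l => mul_nonneg (by norm_num)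
    (mul_nonneg (by norm_num)
      (add_nonneg (mul_nonneg (hp _ _) (hq _ _)) (mul_nonneg (hq _ _) (hp _ _))))
  let F : ℕ → ℕ → ℝ := fun a b =>
    ∑ j ∈ Finset.range (b + 1), ∑ i ∈ Finset.range (a + 1), G i j (a - i) (b - j)
  have hF : ∀ a b, 0 ≤ F a b := fun a b =>
    Finset.sum_nonneg fun j _ => Finset.sum_nonneg fun i _ => hG _ _ _ _
  have hterm : ∀ a b, |I5 t g a b| * τ ^ (a + b) * Mfac (a + b) / derivNorm t g a b ≤ F a b := by
    intro a b
    refine div_le_of_le_mul₀ (derivNorm_nonneg t g a b) (hF a b) ?_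
    have hw : 0 ≤ τ ^ (a + b) * Mfac (a + b) := mul_nonneg (by positivity) (Mfac_pos _).le
    calc _ = |I5 t g a b| * (τ ^ (a + b) * Mfac (a + b)) := by ring
      _ ≤ _ := mul_le_mul_of_nonneg_right (abs_I5_le ht hg hI a b) hw
      _ = (∑ j ∈ Finset.range (b + 1), ∑ i ∈ Finset.range (a + 1),
          69 * (τ ^ (a + b) * Mfac (a + b) * ((a.choose i * b.choose j : ℝ) *
            pairBound t g i j (a - i) (b - j)))) * derivNorm t g a b := by
          simp_rw [← Finset.mul_sum]; ring
      _ ≤ _ := by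
          refine mul_le_mul_of_nonneg_right ?_ (derivNorm_nonneg t g a b)
          refine Finset.sum_le_sum fun j hj => Finset.sum_le_sum fun i hi => ?_
          exact mul_le_mul_of_nonneg_left (weight_mul_pairBound_le g hτ
            (Nat.lt_succ_iff.1 (Finset.mem_range.1 hi))
            (Nat.lt_succ_iff.1 (Finset.mem_range.1 hj))) (by norm_num)
  have hQ : ∀ n, Qterm t τ g (I5 t g) n ≤ ∑ a ∈ Finset.range (n + 1), F a (n - a) := by
    intro n
    refine Finset.sum_le_sum fun a ha => le_trans (le_of_eq ?_) (hterm a (n - a))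
    unfold derivNorm
    rw [Nat.add_sub_of_le (Nat.lt_succ_iff.1 (Finset.mem_range.1 ha))]
  have hPs := sum_supBound_le hτ hle hs N
  have hQs : ∑ i ∈ Finset.range N, ∑ j ∈ Finset.range N, q i j ≤ Xnrm t τ g := by
    simpa using sum_shifted_derivNorm_le hτ hs N 0 0
  have hX := Xnrm_nonneg (t := t) hτ g
  have hprod : ∀ u v : ℕ → ℕ → ℝ, ∑ i ∈ Finset.range N, ∑ k ∈ Finset.range N,
      ∑ j ∈ Finset.range N, ∑ l ∈ Finset.range N, u i j * v k l =
      (∑ i ∈ Finset.range N, ∑ j ∈ Finset.range N, u i j) *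
        ∑ k ∈ Finset.range N, ∑ l ∈ Finset.range N, v k l := by
    intro u v
    rw [Finset.sum_mul_sum]
    exact Finset.sum_congr rfl fun i _ => Finset.sum_congr rfl fun k _ =>
      (Finset.sum_mul_sum _ _ _ _).symm
  calc _ ≤ ∑ n ∈ Finset.range N, ∑ a ∈ Finset.range (n + 1), F a (n - a) :=
        Finset.sum_le_sum fun n _ => hQ n
    _ ≤ ∑ a ∈ Finset.range N, ∑ b ∈ Finset.range N, F a b := sum_triangle_le_sum_square hF N
    _ ≤ ∑ i ∈ Finset.range N, ∑ k ∈ Finset.range N, ∑ j ∈ Finset.range N,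
        ∑ l ∈ Finset.range N, G i j k l := sum_convolution_le hG N
    _ = 2208 * ((∑ i ∈ Finset.range N, ∑ j ∈ Finset.range N, p i j) *
        ∑ i ∈ Finset.range N, ∑ j ∈ Finset.range N, q i j) := by
        simp only [G]
        simp_rw [← Finset.mul_sum, Finset.sum_add_distrib, hprod]
        ring
    _ ≤ 2208 * (8 * ((1 + τ₀) ^ 2 / τ ^ 2) * Xnrm t τ g * Xnrm t τ g) := by
        refine mul_le_mul_of_nonneg_left (mul_le_mul hPs hQs ?_ ?_) (by norm_num)
        · exact Finset.sum_nonneg fun i _ => Finset.sum_nonneg fun j _ => hq i j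
        · positivity
    _ = _ := by ring

/-- estimate of the term `I₅`. -/
theorem estimate_I5 (τ₀ : ℝ) (hτ₀ : 0 < τ₀) :
    ∃ C : ℝ, 0 < C ∧
      ∀ t : ℝ, 0 ≤ t → ∀ g : ℝ → ℝ → ℝ → ℝ, DecaySmooth g → L2cond t g → L2condZ t g →
        ∀ τ : ℝ, 0 < τ → τ ≤ τ₀ →
          Summable (Xel t τ g) → Summable (Del t τ g) →
          ∀ N : ℕ,
            (∑ n ∈ Finset.range N, Qterm t τ g (I5 t g) n) ≤
              C / τ ^ 2 * (Xnrm t τ g + Dnrm t τ g) * Xnrm t τ g := by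
  refine ⟨17664 * (1 + τ₀) ^ 2, by positivity, fun t ht g hg hI _ τ hτ hle hX _ N => ?_⟩
  have hX0 := Xnrm_nonneg (t := t) hτ g
  have hD0 : 0 ≤ Dnrm t τ g := Xnrm_nonneg hτ (pdz g)
  refine (sum_Qterm_I5_le ht hg.1 hI hτ hle hX N).trans ?_
  gcongr
  exact le_add_of_nonneg_right hD0
end
end

section
/- Weighted Poincaré (Treves-type) inequality: let t ≥ 0 and let g : ℝ² × [0,∞) → ℝ be smooth in (x,y), belong to H¹ in z, vanish at z = 0 (g(x,y,0) = 0), and decay to zero sufficiently fast as z → +∞, with θ ⟨r⟩ⁿ ∂^α_h g and θ ⟨r⟩ⁿ ∂^α_h ∂_z g in L²(ℝ² × (0,∞)). Then for every n ∈ ℕ and every multi-index α with |α| = n: (1/(2⟨t⟩)) ‖θ ⟨r⟩ⁿ ∂^α_h g‖²_{L²} ≤ ‖θ ⟨r⟩ⁿ ∂^α_h ∂_z g‖²_{L²}. -/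
open MeasureTheory Filter Set

noncomputable section

/-- A nonnegative integrable function on `(0, ∞)` satisfies `liminf R * u R = 0` at infinity. -/
theorem exists_mul_lt_of_integrableOn_Ioi {u : ℝ → ℝ} (hu : IntegrableOn u (Ioi 0))
    {ε : ℝ} (hε : 0 < ε) (R₀ : ℝ) : ∃ R > R₀, R * u R < ε := by
  by_contra! h
  have hpos : 0 < max R₀ 1 := lt_max_of_lt_right one_pos
  refine not_integrableOn_Ioi_inv (a := max R₀ 1) ?_
  have hu' : IntegrableOn (fun R => ε⁻¹ * u R) (Ioi (max R₀ 1)) :=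
    (hu.mono_set (Ioi_subset_Ioi hpos.le)).const_mul _
  refine Integrable.mono' hu' measurable_inv.aestronglyMeasurable ?_
  filter_upwards [ae_restrict_mem measurableSet_Ioi] with R hR
  have hR0 : 0 < R := hpos.trans hR
  have hle := h R ((le_max_left _ _).trans_lt hR)
  rw [Real.norm_of_nonneg (inv_nonneg.2 hR0.le), inv_mul_eq_div, le_div_iff₀ hε, inv_mul_eq_div,
    div_le_iff₀ hR0]
  linarith

/-- One-dimensional Poincaré inequality with the Gaussian weight `exp (z² / (8T))`. The boundary
term at `0` carries a factor `z`, so no boundary condition is needed. -/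
theorem integral_gaussian_weight_sq_le {T : ℝ} (hT : 0 < T) {f f' : ℝ → ℝ}
    (hf : ∀ z, HasDerivAt f (f' z) z) (hf' : Continuous f')
    (hi : IntegrableOn (fun z => (Real.exp (z ^ 2 / (8 * T)) * f z) ^ 2) (Ioi 0))
    (hi' : IntegrableOn (fun z => (Real.exp (z ^ 2 / (8 * T)) * f' z) ^ 2) (Ioi 0)) :
    1 / (2 * T) * ∫ z in Ioi 0, (Real.exp (z ^ 2 / (8 * T)) * f z) ^ 2 ≤
      ∫ z in Ioi 0, (Real.exp (z ^ 2 / (8 * T)) * f' z) ^ 2 := by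
  have hfc : Continuous f := continuous_iff_continuousAt.2 fun z => (hf z).continuousAt
  set w : ℝ → ℝ := fun z => Real.exp (z ^ 2 / (8 * T)) with hw
  have hwc : Continuous w := by fun_prop
  have hwd (z : ℝ) : HasDerivAt w (w z * (z / (4 * T))) z := by
    have h := ((hasDerivAt_pow 2 z).div_const (8 * T)).exp
    refine h.congr_deriv ?_
    change w z * _ = _
    field_simp
    ring
  set B : ℝ → ℝ := fun z => 1 / (2 * T) * (z * (w z * f z) ^ 2) with hB
  set B' : ℝ → ℝ := fun z => 1 / (2 * T) * ((w z * f z) ^ 2 +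
    z * (2 * (w z * f z) * (w z * (z / (4 * T)) * f z + w z * f' z))) with hB'
  have hBd (z : ℝ) : HasDerivAt B (B' z) z := by
    have h := ((hasDerivAt_id z).mul (((hwd z).mul (hf z)).pow 2)).const_mul (1 / (2 * T))
    refine h.congr_deriv ?_
    simp only [hB', id, Pi.pow_apply, Pi.mul_apply]
    ring
  have hBc : Continuous B' := by fun_prop
  have key {R : ℝ} (hR : 0 ≤ R) : 1 / (2 * T) * (∫ z in 0..R, (w z * f z) ^ 2) ≤
      (∫ z in Ioi 0, (w z * f' z) ^ 2) + B R := by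
    have hfund : ∫ z in 0..R, B' z = B R := by
      rw [intervalIntegral.integral_eq_sub_of_hasDerivAt (fun z _ => hBd z)
        (hBc.intervalIntegrable _ _)]
      simp [hB]
    have hmono : ∫ z in 0..R, (w z * f' z) ^ 2 ≤ ∫ z in Ioi 0, (w z * f' z) ^ 2 := by
      rw [intervalIntegral.integral_of_le hR]
      exact setIntegral_mono_set hi' (ae_of_all _ fun z => sq_nonneg _)
        Ioc_subset_Ioi_self.eventuallyLE
    have hpt : ∫ z in 0..R, 1 / (2 * T) * (w z * f z) ^ 2 ≤
        ∫ z in 0..R, ((w z * f' z) ^ 2 + B' z) := by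
      refine intervalIntegral.integral_mono_on hR
        (Continuous.intervalIntegrable (by fun_prop) _ _)
        (Continuous.intervalIntegrable (by fun_prop) _ _) fun z _ => ?_
      have hsq : (w z * f' z) ^ 2 + B' z - 1 / (2 * T) * (w z * f z) ^ 2 =
          (w z * f' z + z / (2 * T) * (w z * f z)) ^ 2 := by
        simp only [hB']
        field_simp
        ring
      nlinarith [sq_nonneg (w z * f' z + z / (2 * T) * (w z * f z))]
    rw [intervalIntegral.integral_add (Continuous.intervalIntegrable (by fun_prop) _ _)
      (hBc.intervalIntegrable _ _), hfund, intervalIntegral.integral_const_mul] at hpt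
    linarith
  have hlim : Tendsto (fun R => 1 / (2 * T) * ∫ z in 0..R, (w z * f z) ^ 2) atTop
      (nhds (1 / (2 * T) * ∫ z in Ioi 0, (w z * f z) ^ 2)) :=
    (intervalIntegral_tendsto_integral_Ioi 0 hi tendsto_id).const_mul _
  by_contra! hlt
  obtain ⟨m, hm, hm'⟩ := exists_between hlt
  obtain ⟨R₁, hR₁⟩ := eventually_atTop.1 (hlim.eventually_const_lt hm')
  obtain ⟨R, hR, hsmall⟩ := exists_mul_lt_of_integrableOn_Ioi hi
    (ε := 2 * T * (m - ∫ z in Ioi 0, (w z * f' z) ^ 2)) (by nlinarith) (max R₁ 0)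
  have hBR : B R < m - ∫ z in Ioi 0, (w z * f' z) ^ 2 := by
    simp only [hB]
    rw [one_div, inv_mul_eq_div, div_lt_iff₀ (by positivity)]
    linarith
  have h1 := hR₁ R ((le_max_left _ _).trans hR.le)
  have h2 := key ((le_max_right R₁ 0).trans hR.le)
  linarith

/-- Joint smoothness of a function of three real variables. -/
def Smooth₃ (f : ℝ → ℝ → ℝ → ℝ) : Prop :=
  ContDiff ℝ (⊤ : ℕ∞) (fun p : ℝ × ℝ × ℝ => f p.1 p.2.1 p.2.2)

namespace Smooth₃

variable {f : ℝ → ℝ → ℝ → ℝ}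

theorem hasFDerivAt (hf : Smooth₃ f) (p : ℝ × ℝ × ℝ) :
    HasFDerivAt (fun p : ℝ × ℝ × ℝ => f p.1 p.2.1 p.2.2)
      (fderiv ℝ (fun p : ℝ × ℝ × ℝ => f p.1 p.2.1 p.2.2) p) p :=
  (hf.differentiable (by simp) p).hasFDerivAt

theorem pdx_eq (hf : Smooth₃ f) (x y z : ℝ) : pdx f x y z =
    fderiv ℝ (fun p : ℝ × ℝ × ℝ => f p.1 p.2.1 p.2.2) (x, y, z) (1, 0, 0) :=
  ((hf.hasFDerivAt (x, y, z)).comp_hasDerivAt (f := fun s => (s, y, z)) x ((hasDerivAt_id x).prodMk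
    ((hasDerivAt_const x y).prodMk (hasDerivAt_const x z)))).deriv

theorem pdy_eq (hf : Smooth₃ f) (x y z : ℝ) : pdy f x y z =
    fderiv ℝ (fun p : ℝ × ℝ × ℝ => f p.1 p.2.1 p.2.2) (x, y, z) (0, 1, 0) :=
  ((hf.hasFDerivAt (x, y, z)).comp_hasDerivAt (f := fun s => (x, s, z)) y ((hasDerivAt_const y x).prodMk
    ((hasDerivAt_id y).prodMk (hasDerivAt_const y z)))).deriv

theorem hasDerivAt_snd_snd (hf : Smooth₃ f) (x y z : ℝ) : HasDerivAt (f x y)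
    (fderiv ℝ (fun p : ℝ × ℝ × ℝ => f p.1 p.2.1 p.2.2) (x, y, z) (0, 0, 1)) z :=
  (hf.hasFDerivAt (x, y, z)).comp_hasDerivAt (f := fun s => (x, y, s)) z ((hasDerivAt_const z x).prodMk
    ((hasDerivAt_const z y).prodMk (hasDerivAt_id z)))

theorem pdz_eq (hf : Smooth₃ f) (x y z : ℝ) : pdz f x y z =
    fderiv ℝ (fun p : ℝ × ℝ × ℝ => f p.1 p.2.1 p.2.2) (x, y, z) (0, 0, 1) :=
  (hf.hasDerivAt_snd_snd x y z).deriv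

theorem hasDerivAt_pdz (hf : Smooth₃ f) (x y z : ℝ) : HasDerivAt (f x y) (pdz f x y z) z := by
  rw [hf.pdz_eq]
  exact hf.hasDerivAt_snd_snd x y z

theorem contDiff_fderiv_apply (hf : Smooth₃ f) (v : ℝ × ℝ × ℝ) : ContDiff ℝ (⊤ : ℕ∞)
    fun p => fderiv ℝ (fun p : ℝ × ℝ × ℝ => f p.1 p.2.1 p.2.2) p v :=
  (ContDiff.fderiv_right hf (by simp)).clm_apply contDiff_const

theorem pdx (hf : Smooth₃ f) : Smooth₃ (pdx f) := by
  simpa only [Smooth₃, hf.pdx_eq] using hf.contDiff_fderiv_apply (1, 0, 0)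

theorem pdy (hf : Smooth₃ f) : Smooth₃ (pdy f) := by
  simpa only [Smooth₃, hf.pdy_eq] using hf.contDiff_fderiv_apply (0, 1, 0)

theorem pdz (hf : Smooth₃ f) : Smooth₃ (pdz f) := by
  simpa only [Smooth₃, hf.pdz_eq] using hf.contDiff_fderiv_apply (0, 0, 1)

theorem fderiv_fderiv_comm (hf : Smooth₃ f) (p v w : ℝ × ℝ × ℝ) :
    fderiv ℝ (fun q => fderiv ℝ (fun p : ℝ × ℝ × ℝ => f p.1 p.2.1 p.2.2) q v) p w =
      fderiv ℝ (fun q => fderiv ℝ (fun p : ℝ × ℝ × ℝ => f p.1 p.2.1 p.2.2) q w) p v := by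
  have hd : DifferentiableAt ℝ (fderiv ℝ fun p : ℝ × ℝ × ℝ => f p.1 p.2.1 p.2.2) p :=
    (ContDiff.fderiv_right (m := 1) hf (WithTop.coe_le_coe.2 le_top)).differentiable (by simp) p
  have hs : IsSymmSndFDerivAt ℝ (fun p : ℝ × ℝ × ℝ => f p.1 p.2.1 p.2.2) p :=
    (ContDiff.contDiffAt hf).isSymmSndFDerivAt
      (by simpa using WithTop.coe_le_coe.2 (le_top : (2 : ℕ∞) ≤ ⊤))
  rw [fderiv_clm_apply hd (differentiableAt_const v),
    fderiv_clm_apply hd (differentiableAt_const w)]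
  simpa using hs.eq w v

theorem pdz_pdx (hf : Smooth₃ f) : _root_.pdz (_root_.pdx f) = _root_.pdx (_root_.pdz f) := by
  funext x y z
  rw [hf.pdx.pdz_eq, hf.pdz.pdx_eq]
  simp only [hf.pdx_eq, hf.pdz_eq]
  exact hf.fderiv_fderiv_comm _ _ _

theorem pdz_pdy (hf : Smooth₃ f) : _root_.pdz (_root_.pdy f) = _root_.pdy (_root_.pdz f) := by
  funext x y z
  rw [hf.pdy.pdz_eq, hf.pdz.pdy_eq]
  simp only [hf.pdy_eq, hf.pdz_eq]
  exact hf.fderiv_fderiv_comm _ _ _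

theorem iterate_pdx (hf : Smooth₃ f) (a : ℕ) : Smooth₃ (_root_.pdx^[a] f) := by
  induction a with
  | zero => exact hf
  | succ a ih => rw [Function.iterate_succ_apply']; exact ih.pdx

theorem iterate_pdy (hf : Smooth₃ f) (b : ℕ) : Smooth₃ (_root_.pdy^[b] f) := by
  induction b with
  | zero => exact hf
  | succ b ih => rw [Function.iterate_succ_apply']; exact ih.pdy

theorem pdh (hf : Smooth₃ f) (a b : ℕ) : Smooth₃ (pdh a b f) :=
  (hf.iterate_pdy b).iterate_pdx a

theorem pdz_iterate_pdx (hf : Smooth₃ f) (a : ℕ) :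
    _root_.pdz (_root_.pdx^[a] f) = _root_.pdx^[a] (_root_.pdz f) := by
  induction a with
  | zero => rfl
  | succ a ih => rw [Function.iterate_succ_apply', Function.iterate_succ_apply',
      (hf.iterate_pdx a).pdz_pdx, ih]

theorem pdz_iterate_pdy (hf : Smooth₃ f) (b : ℕ) :
    _root_.pdz (_root_.pdy^[b] f) = _root_.pdy^[b] (_root_.pdz f) := by
  induction b with
  | zero => rfl
  | succ b ih => rw [Function.iterate_succ_apply', Function.iterate_succ_apply',
      (hf.iterate_pdy b).pdz_pdy, ih]

theorem pdz_pdh (hf : Smooth₃ f) (a b : ℕ) :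
    _root_.pdz (_root_.pdh a b f) = _root_.pdh a b (_root_.pdz f) := by
  rw [_root_.pdh, (hf.iterate_pdy b).pdz_iterate_pdx, hf.pdz_iterate_pdy, _root_.pdh]

theorem continuous_apply_apply (hf : Smooth₃ f) (x y : ℝ) : Continuous (f x y) :=
  (ContDiff.continuous hf).comp (by fun_prop : Continuous fun z : ℝ => (x, y, z))

end Smooth₃

theorem volume_restrict_upper_half_space :
    (volume : Measure (ℝ × ℝ × ℝ)).restrict {p | 0 < p.2.2} =
      (volume : Measure ℝ).prod ((volume : Measure ℝ).prod (volume.restrict (Ioi 0))) := by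
  have hset : {p : ℝ × ℝ × ℝ | 0 < p.2.2} = univ ×ˢ (univ ×ˢ Ioi 0) := by
    ext p
    simp
  rw [hset, Measure.volume_eq_prod, ← Measure.prod_restrict, Measure.restrict_univ,
    Measure.volume_eq_prod, ← Measure.prod_restrict, Measure.restrict_univ]

section TripleProduct

variable {α β γ : Type*} [MeasurableSpace α] [MeasurableSpace β] [MeasurableSpace γ]
  {μ : Measure α} {ν : Measure β} {ρ : Measure γ} [SFinite μ] [SFinite ν] [SFinite ρ]

theorem integral_prod_prod {F : α × β × γ → ℝ} (hF : Integrable F (μ.prod (ν.prod ρ))) :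
    ∫ x, ∫ y, ∫ z, F (x, y, z) ∂ρ ∂ν ∂μ = ∫ p, F p ∂μ.prod (ν.prod ρ) := by
  rw [integral_prod F hF]
  refine integral_congr_ae ?_
  filter_upwards [hF.prod_right_ae] with x hx
  exact (integral_prod _ hx).symm

theorem mul_integral_prod_prod_le {F G : α × β × γ → ℝ} (hF : Integrable F (μ.prod (ν.prod ρ)))
    (hG : Integrable G (μ.prod (ν.prod ρ))) (c : ℝ)
    (h : ∀ x y, Integrable (fun z => F (x, y, z)) ρ → Integrable (fun z => G (x, y, z)) ρ →
      c * ∫ z, F (x, y, z) ∂ρ ≤ ∫ z, G (x, y, z) ∂ρ) :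
    c * ∫ x, ∫ y, ∫ z, F (x, y, z) ∂ρ ∂ν ∂μ ≤ ∫ x, ∫ y, ∫ z, G (x, y, z) ∂ρ ∂ν ∂μ := by
  rw [integral_prod_prod hF, integral_prod_prod hG, ← sub_nonneg, ← integral_const_mul,
    ← integral_sub hG (hF.const_mul c),
    ← integral_prod_prod (F := fun p => G p - c * F p) (hG.sub (hF.const_mul c))]
  refine integral_nonneg_of_ae ?_
  filter_upwards [hF.prod_right_ae, hG.prod_right_ae] with x hFx hGx
  refine integral_nonneg_of_ae ?_
  filter_upwards [hFx.prod_right_ae, hGx.prod_right_ae] with y hFxy hGxy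
  simp only [Pi.zero_apply]
  rw [integral_sub hGxy (hFxy.const_mul c), integral_const_mul, sub_nonneg]
  exact h x y hFxy hGxy

end TripleProduct

theorem L2w_sq (t lam : ℝ) (n : ℕ) (f : ℝ → ℝ → ℝ → ℝ) : L2w t lam n f ^ 2 =
    ∫ x : ℝ, ∫ y : ℝ, ∫ z in Ioi (0 : ℝ), (thw t lam z * angR x y ^ n * f x y z) ^ 2 :=
  Real.sq_sqrt <| integral_nonneg fun _ => integral_nonneg fun _ => integral_nonneg fun _ =>
    sq_nonneg _

/-- weighted Poincaré (Treves-type) inequality. -/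
theorem weighted_poincare (t : ℝ) (ht : 0 ≤ t) (g : ℝ → ℝ → ℝ → ℝ)
    (hg : DecaySmooth g) (hbd : ∀ x y : ℝ, g x y 0 = 0)
    (hL2 : L2cond t g) (hL2z : L2condZ t g) :
    ∀ n a b : ℕ, a + b = n →
      1 / (2 * angT t) * L2w t 1 n (pdh a b g) ^ 2 ≤ L2w t 1 n (pdh a b (pdz g)) ^ 2 := by
  rintro _ a b rfl
  have hT : 0 < angT t := by
    unfold angT
    linarith
  have hs : Smooth₃ g := hg.1
  have hF := hL2 a b
  have hG := hL2z a b
  rw [volume_restrict_upper_half_space] at hF hG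
  rw [L2w_sq, L2w_sq]
  refine mul_integral_prod_prod_le hF hG _ fun x y hFxy hGxy => ?_
  simp only [thw, one_mul, mul_assoc (Real.exp _)] at hFxy hGxy ⊢
  refine integral_gaussian_weight_sq_le hT (fun z => ?_) ?_ hFxy hGxy
  · rw [← hs.pdz_pdh]
    exact ((hs.pdh a b).hasDerivAt_pdz x y z).const_mul _
  · exact continuous_const.mul ((hs.pdz.pdh a b).continuous_apply_apply x y)
end
end
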